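/- For every infinite cardinal k, the space B*(k) is densely homogeneous with respect to the space M^{II}_k: for any two dense subsets X₁, X₂ of B*(k), each homeomorphic to M^{II}_k, there is a homeomorphism of B*(k) onto itself carrying X₁ onto X₂. -/

import Mathlib

open Topology Set Filter

universe u v

noncomputable section

/-- Strong zero-dimensionality (`Ind X = 0`): any two disjoint closed sets
can be separated by a clopen set. -/
def StronglyZeroDim (X : Type*) [TopologicalSpace X] : Prop :=
  ∀ A B : Set X, IsClosed A → IsClosed B → Disjoint A B →
    ∃ U : Set X, IsClopen U ∧ A ⊆ U ∧ Disjoint B U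

/-- The topological weight of a space: the least cardinality of a base. -/
def topWeight (X : Type u) [TopologicalSpace X] : Cardinal.{u} :=
  ⨅ B : {B : Set (Set X) // TopologicalSpace.IsTopologicalBasis B}, Cardinal.mk B.1

/-- The space has a base of cardinality `< k`. -/
def WeightLT (X : Type u) [TopologicalSpace X] (k : Cardinal.{u}) : Prop :=
  ∃ B : Set (Set X), TopologicalSpace.IsTopologicalBasis B ∧ Cardinal.mk B < k

/-- Every point has a neighborhood of weight `< k`. -/
def LocallyWeightLT (X : Type u) [TopologicalSpace X] (k : Cardinal.{u}) : Prop :=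
  ∀ x : X, ∃ s : Set X, s ∈ nhds x ∧ WeightLT ↥s k

/-- `X ∈ σLW(<k)`: `X` is a countable union of subspaces, each locally of weight `< k`. -/
def SigmaLW (X : Type u) [TopologicalSpace X] (k : Cardinal.{u}) : Prop :=
  ∃ S : ℕ → Set X, (⋃ n, S n) = Set.univ ∧ ∀ n, LocallyWeightLT ↥(S n) k

/-- A `G_δσ`-subset: a countable union of `G_δ`-sets. -/
def IsGdeltaSigma {Y : Type*} [TopologicalSpace Y] (s : Set Y) : Prop :=
  ∃ G : ℕ → Set Y, (∀ n, IsGδ (G n)) ∧ s = ⋃ n, G n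

/-- An `F_σ`-subset: a countable union of closed sets. -/
def IsFsigmaSet {Y : Type*} [TopologicalSpace Y] (s : Set Y) : Prop :=
  ∃ F : ℕ → Set Y, (∀ n, IsClosed (F n)) ∧ s = ⋃ n, F n

/-- An `F_σδ`-subset: a countable intersection of `F_σ`-sets. -/
def IsFsigmaDelta {Y : Type*} [TopologicalSpace Y] (s : Set Y) : Prop :=
  ∃ F : ℕ → Set Y, (∀ n, IsFsigmaSet (F n)) ∧ s = ⋂ n, F n

/-- An absolute `G_δσ`-set: a metrizable space whose image under every embedding
into a metrizable space is a countable union of `G_δ`-sets. -/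
def AbsGdeltaSigma (X : Type u) [TopologicalSpace X] : Prop :=
  TopologicalSpace.MetrizableSpace X ∧
    ∀ (Y : Type u) [TopologicalSpace Y] [TopologicalSpace.MetrizableSpace Y]
      (f : X → Y), Topology.IsEmbedding f → IsGdeltaSigma (Set.range f)

/-- An absolute `F_σδ`-set: a metrizable space whose image under every embedding
into a metrizable space is an `F_σδ`-set. -/
def AbsFsigmaDelta (X : Type u) [TopologicalSpace X] : Prop :=
  TopologicalSpace.MetrizableSpace X ∧
    ∀ (Y : Type u) [TopologicalSpace Y] [TopologicalSpace.MetrizableSpace Y]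
      (f : X → Y), Topology.IsEmbedding f → IsFsigmaDelta (Set.range f)

/-- `X ∈ σLW(<k) + 𝒢_δσ` : `X = A ∪ B` with `A ∈ σLW(<k)` and `B` an absolute
`G_δσ`-set. -/
def SLWplusGDS (X : Type u) [TopologicalSpace X] (k : Cardinal.{u}) : Prop :=
  ∃ A B : Set X, A ∪ B = Set.univ ∧ SigmaLW ↥A k ∧ AbsGdeltaSigma ↥B

/-- No nonempty open subspace is `σLW(<k) + 𝒢_δσ`. -/
def NowhereSLWplusGDS (X : Type u) [TopologicalSpace X] (k : Cardinal.{u}) : Prop :=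
  ∀ U : Set X, IsOpen U → U.Nonempty → ¬ SLWplusGDS ↥U k

/-- A space is of first category if it is meager in itself. -/
def FirstCategory (X : Type*) [TopologicalSpace X] : Prop :=
  IsMeagre (Set.univ : Set X)

/-- A Souslin (analytic) subset of a space:
`s = ⋃_{t ∈ ω^ω} ⋂_n F(t↾n)` for a family of closed sets indexed by finite tuples. -/
def IsSuslinIn {Y : Type*} [TopologicalSpace Y] (s : Set Y) : Prop :=
  ∃ F : List ℕ → Set Y, (∀ l, IsClosed (F l)) ∧
    s = ⋃ t : ℕ → ℕ, ⋂ n : ℕ, F (List.ofFn fun i : Fin n => t i)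

/-- An absolute Souslin space: metrizable, and Souslin in every completely metrizable
space into which it embeds. -/
def AbsSuslin (X : Type u) [TopologicalSpace X] : Prop :=
  TopologicalSpace.MetrizableSpace X ∧
    ∀ (Y : Type u) [MetricSpace Y] [CompleteSpace Y] (f : X → Y),
      Topology.IsEmbedding f → IsSuslinIn (Set.range f)

/-- An h-homogeneous space: every nonempty clopen subset is homeomorphic to the
whole space. -/
def HHomogeneous (X : Type*) [TopologicalSpace X] : Prop :=
  ∀ U : Set X, IsClopen U → U.Nonempty → Nonempty (↥U ≃ₜ X)

/-- A discrete family of sets: every point has a neighborhood meeting at most one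
member of the family. -/
def DiscreteFamily {X : Type*} [TopologicalSpace X] {ι : Type*} (f : ι → Set X) : Prop :=
  ∀ x : X, ∃ U ∈ nhds x, {i | (f i ∩ U).Nonempty}.Subsingleton

/-- A discrete space of cardinality `k`. -/
def DiscT (k : Cardinal.{u}) : Type u := k.out

instance (k : Cardinal.{u}) : TopologicalSpace (DiscT k) := ⊥
instance (k : Cardinal.{u}) : DiscreteTopology (DiscT k) := ⟨rfl⟩

/-- The Baire space `B(k) = k^ω`. -/
def BaireB (k : Cardinal.{u}) : Type u := ℕ → DiscT k

instance (k : Cardinal.{u}) : TopologicalSpace (BaireB k) :=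
  inferInstanceAs (TopologicalSpace (ℕ → DiscT k))

open Classical in
/-- The discrete factor of `B*(k)`: two points if `k = ℵ₀`, and `k` points otherwise. -/
def StarT (k : Cardinal.{u}) : Type u :=
  if k = Cardinal.aleph0 then ULift Bool else DiscT k

instance (k : Cardinal.{u}) : TopologicalSpace (StarT k) := ⊥
instance (k : Cardinal.{u}) : DiscreteTopology (StarT k) := ⟨rfl⟩

/-- `B*(k)`: the Cantor set `2^ω` if `k = ℵ₀`, and the Baire space `B(k)` if `k > ℵ₀`. -/
def BaireStar (k : Cardinal.{u}) : Type u := ℕ → StarT k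

instance (k : Cardinal.{u}) : TopologicalSpace (BaireStar k) :=
  inferInstanceAs (TopologicalSpace (ℕ → StarT k))

/-- A discrete space of cardinality `k` (for infinite `k`), with a distinguished basepoint. -/
def QBase (k : Cardinal.{u}) : Type u := DiscT k ⊕ PUnit.{u + 1}

instance (k : Cardinal.{u}) : TopologicalSpace (QBase k) := ⊥
instance (k : Cardinal.{u}) : DiscreteTopology (QBase k) := ⟨rfl⟩

/-- `Q(k)`: the σ-product of `ω` copies of a discrete space of cardinality `k`, i.e.
the subspace of the product consisting of the sequences eventually equal to the basepoint. -/
def Qk (k : Cardinal.{u}) : Type u :=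
  {x : ℕ → QBase k // ∀ᶠ n in Filter.atTop, x n = Sum.inr PUnit.unit}

instance (k : Cardinal.{u}) : TopologicalSpace (Qk k) :=
  inferInstanceAs (TopologicalSpace
    {x : ℕ → QBase k // ∀ᶠ n in Filter.atTop, x n = Sum.inr PUnit.unit})

/-- The countable power `Q(k)^ω`. -/
def QkOmega (k : Cardinal.{u}) : Type u := ℕ → Qk k

instance (k : Cardinal.{u}) : TopologicalSpace (QkOmega k) :=
  inferInstanceAs (TopologicalSpace (ℕ → Qk k))

/-- `Z` is homeomorphic to `Q(k)^ω`. -/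
def IsQkOmega (k : Cardinal.{u}) (Z : Type*) [TopologicalSpace Z] : Prop :=
  Nonempty (Z ≃ₜ QkOmega k)

/-- `Z` is homeomorphic to `A^{II}_k`, the complement in `B*(k)` of a dense copy of
`Q(k)^ω`. -/
def IsAII (k : Cardinal.{u}) (Z : Type*) [TopologicalSpace Z] : Prop :=
  ∃ A : Set (BaireStar k), Dense A ∧ IsQkOmega k ↥A ∧ Nonempty (Z ≃ₜ ↥(Aᶜ))

/-- `Z` is homeomorphic to `A^I_k = Q × A^{II}_k`. -/
def IsAI (k : Cardinal.{u}) (Z : Type*) [TopologicalSpace Z] : Prop :=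
  ∃ A : Set (BaireStar k), Dense A ∧ IsQkOmega k ↥A ∧ Nonempty (Z ≃ₜ (ℚ × ↥(Aᶜ)))

/-- `Z` is homeomorphic to `M^{II}_k`, the complement in `B*(k)` of a dense copy of
`A^I_k`. -/
def IsMII (k : Cardinal.{u}) (Z : Type*) [TopologicalSpace Z] : Prop :=
  ∃ Y : Set (BaireStar k), Dense Y ∧ IsAI k ↥Y ∧ Nonempty (Z ≃ₜ ↥(Yᶜ))

/-- `X ∈ 𝓕_σδ ∖ σLW(<k)`: `X` is homeomorphic to `F ∖ L` for some absolute
`F_σδ`-space `F` and some `L ⊆ F` with `L ∈ σLW(<k)`. -/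
def FsdMinusSLW (X : Type u) [TopologicalSpace X] (k : Cardinal.{u}) : Prop :=
  ∃ (F : TopCat.{u}) (L : Set F), AbsFsigmaDelta ↥F ∧ SigmaLW ↥L k ∧
    Nonempty (X ≃ₜ ↥(Lᶜ))

/-- No nonempty open subspace is in the class `𝓕_σδ ∖ σLW(<k)`. -/
def NowhereFsdMinusSLW (X : Type u) [TopologicalSpace X] (k : Cardinal.{u}) : Prop :=
  ∀ U : Set X, IsOpen U → U.Nonempty → ¬ FsdMinusSLW ↥U k

/-- A topologically complete (i.e. completely metrizable) space. -/
def CompletelyMetrizable (X : Type*) [t : TopologicalSpace X] : Prop :=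
  ∃ m : MetricSpace X, m.toUniformSpace.toTopologicalSpace = t ∧
    @CompleteSpace X m.toUniformSpace

end

namespace DH

/-- Agreement of the first `n` coordinates. -/
def Ag {T : Type*} (n : ℕ) (x y : ℕ → T) : Prop := ∀ i < n, x i = y i

section Ag
variable {T : Type*} {n m : ℕ} {x y z : ℕ → T}

theorem Ag.refl (n : ℕ) (x : ℕ → T) : Ag n x x := fun _ _ => rfl
theorem Ag.symm (h : Ag n x y) : Ag n y x := fun i hi => (h i hi).symm
theorem Ag.trans (h : Ag n x y) (h' : Ag n y z) : Ag n x z :=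
  fun i hi => (h i hi).trans (h' i hi)
theorem Ag.mono (h : Ag n x y) (hm : m ≤ n) : Ag m x y := fun i hi => h i (hi.trans_le hm)
theorem Ag.zero (x y : ℕ → T) : Ag 0 x y := fun i hi => absurd hi (Nat.not_lt_zero i)
theorem eq_of_ag (h : ∀ n, Ag n x y) : x = y := funext fun i => h (i + 1) i (Nat.lt_succ_self i)

theorem ag_iff_res : Ag n x y ↔ PiNat.res x n = PiNat.res y n := by
  rw [PiNat.res_eq_res]; rfl

variable [TopologicalSpace T] [DiscreteTopology T]

theorem isOpen_ag (n : ℕ) (x : ℕ → T) : IsOpen {y | Ag n x y} := by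
  have : {y | Ag n x y} = PiNat.cylinder x n := by
    ext y; simp only [mem_ofPred_eq, PiNat.cylinder, Ag]
    exact ⟨fun h i hi => (h i hi).symm, fun h i hi => (h i hi).symm⟩
  rw [this]; exact PiNat.isOpen_cylinder _ x n

theorem mem_nhds_iff_ag {s : Set (ℕ → T)} : s ∈ 𝓝 x ↔ ∃ n, ∀ y, Ag n x y → y ∈ s := by
  constructor
  · intro h
    obtain ⟨u, hu, hxu, hus⟩ :=
      (PiNat.isTopologicalBasis_cylinders (fun _ : ℕ => T)).mem_nhds_iff.1 h
    obtain ⟨z, n, rfl⟩ := hu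
    refine ⟨n, fun y hy => hus ?_⟩
    intro i hi
    rw [← hy i hi]; exact hxu i hi
  · rintro ⟨n, hn⟩
    exact mem_of_superset ((isOpen_ag n x).mem_nhds (Ag.refl n x)) hn

theorem mem_closure_iff_ag {s : Set (ℕ → T)} : x ∈ closure s ↔ ∀ n, ∃ y ∈ s, Ag n x y := by
  rw [mem_closure_iff_nhds]
  constructor
  · intro h n
    obtain ⟨y, hy, hys⟩ := h _ ((isOpen_ag n x).mem_nhds (Ag.refl n x))
    exact ⟨y, hys, hy⟩
  · intro h t ht
    obtain ⟨n, hn⟩ := mem_nhds_iff_ag.1 ht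
    obtain ⟨y, hys, hy⟩ := h n
    exact ⟨y, hn y hy, hys⟩

theorem continuousWithinAt_iff_ag {X : Type*} [TopologicalSpace X] {f : X → ℕ → T} {s : Set X}
    {a : X} : ContinuousWithinAt f s a ↔ ∀ n, ∀ᶠ b in 𝓝[s] a, Ag n (f a) (f b) := by
  constructor
  · intro h n
    exact h ((isOpen_ag n (f a)).mem_nhds (Ag.refl n _))
  · intro h t ht
    obtain ⟨n, hn⟩ := mem_nhds_iff_ag.1 ht
    exact (h n).mono fun b hb => hn _ hb

theorem continuous_iff_ag {X : Type*} [TopologicalSpace X] {f : X → ℕ → T} :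
    Continuous f ↔ ∀ a n, ∀ᶠ b in 𝓝 a, Ag n (f a) (f b) := by
  rw [continuous_iff_continuousAt]
  refine forall_congr' fun a => ?_
  rw [← continuousWithinAt_univ, continuousWithinAt_iff_ag, nhdsWithin_univ]

theorem continuousOn_pi_ag {T' : Type*} [TopologicalSpace T'] [DiscreteTopology T']
    {f : (ℕ → T') → ℕ → T} {s : Set (ℕ → T')} (h : ContinuousOn f s) {a : ℕ → T'} (ha : a ∈ s)
    (n : ℕ) : ∃ m, ∀ b ∈ s, Ag m a b → Ag n (f a) (f b) := by
  have := continuousWithinAt_iff_ag.1 (h a ha) n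
  rw [eventually_nhdsWithin_iff] at this
  obtain ⟨m, hm⟩ := mem_nhds_iff_ag.1 this
  exact ⟨m, fun b hb hab => hm b hab hb⟩

end Ag

section Gdelta
variable {X K : Type*} [TopologicalSpace X] [TopologicalSpace K]

theorem isGδ_closed [TopologicalSpace.MetrizableSpace X] {s : Set X} (h : IsClosed s) :
    IsGδ s := by
  let _ := TopologicalSpace.metrizableSpaceMetric X
  exact h.isGδ

/-- preimage of a `Gδ` set under a map continuous on a `Gδ` set -/
theorem isGδ_inter_preimage {f : X → K} {s : Set X} (hs : IsGδ s) (hf : ContinuousOn f s)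
    {t : Set K} (ht : IsGδ t) : IsGδ (s ∩ f ⁻¹' t) := by
  obtain ⟨U, hU, rfl⟩ := ht.eq_iInter_nat
  have : ∀ n, ∃ O, IsOpen O ∧ f ⁻¹' U n ∩ s = O ∩ s := fun n => by
    obtain ⟨O, hO, h⟩ := (continuousOn_iff'.1 hf) (U n) (hU n)
    exact ⟨O, hO, h⟩
  choose O hO h using this
  have e : s ∩ f ⁻¹' (⋂ n, U n) = s ∩ ⋂ n, O n := by
    ext x
    simp only [mem_inter_iff, mem_preimage, mem_iInter]
    refine and_congr_right fun hx => forall_congr' fun n => ?_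
    have := Set.ext_iff.1 (h n) x
    simpa [hx] using this
  rw [e]
  exact hs.inter (IsGδ.iInter_of_isOpen hO)

theorem isGδ_fixed [TopologicalSpace.MetrizableSpace X] {f : X → X} {s : Set X}
    (hs : IsGδ s) (hf : ContinuousOn f s) : IsGδ (s ∩ {x | f x = x}) := by
  have h1 : ContinuousOn (fun x => (f x, x)) s := hf.prodMk continuousOn_id
  have h2 : IsGδ (Set.diagonal X) := isGδ_closed isClosed_diagonal
  exact isGδ_inter_preimage hs h1 h2

end Gdelta

/-- A homeomorphism between `Gδ` subsets. -/
structure GH (X K : Type*) [TopologicalSpace X] [TopologicalSpace K] where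
  e : PartialEquiv X K
  cs : ContinuousOn e e.source
  ct : ContinuousOn e.symm e.target
  gs : IsGδ e.source
  gt : IsGδ e.target

/-- Composition. -/
def GH.trans {X K L : Type*} [TopologicalSpace X] [TopologicalSpace K] [TopologicalSpace L]
    (E : GH X K) (F : GH K L) : GH X L where
  e := E.e.trans F.e
  cs := by
    rw [PartialEquiv.trans_source]
    exact F.cs.comp (E.cs.mono inter_subset_left) fun x hx => hx.2
  ct := by
    rw [PartialEquiv.trans_target]
    exact E.ct.comp (F.ct.mono inter_subset_left) fun x hx => hx.2
  gs := by
    rw [PartialEquiv.trans_source]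
    exact isGδ_inter_preimage E.gs E.cs F.gs
  gt := by
    rw [PartialEquiv.trans_target]
    exact isGδ_inter_preimage F.gt F.ct E.gt

/-- A homeomorphism. -/
def GH.ofHomeo {X K : Type*} [TopologicalSpace X] [TopologicalSpace K] (h : X ≃ₜ K) : GH X K where
  e := h.toEquiv.toPartialEquiv
  cs := h.continuous.continuousOn
  ct := h.symm.continuous.continuousOn
  gs := by simp
  gt := by simp

section Lav
variable {X : Type*} [TopologicalSpace X] [TopologicalSpace.MetrizableSpace X]
variable {T T' : Type*} [TopologicalSpace T] [DiscreteTopology T]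
  [TopologicalSpace T'] [DiscreteTopology T']

theorem extend_Gδ [Nonempty T] (S : Set X) (f : X → ℕ → T) (hf : ContinuousOn f S) :
    ∃ (G : Set X) (φ : X → ℕ → T), IsGδ G ∧ S ⊆ G ∧ G ⊆ closure S ∧ ContinuousOn φ G ∧
      ∀ s ∈ S, φ s = f s := by
  classical
  let Pr : ℕ → Set X → Prop := fun n O => IsOpen O ∧ ∀ s ∈ S, ∀ s' ∈ S, s ∈ O → s' ∈ O →
    Ag n (f s) (f s')
  let G : Set X := closure S ∩ ⋂ n, ⋃₀ {O | Pr n O}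
  have hG : ∀ x ∈ G, ∃ y : ℕ → T, ∀ n O, Pr n O → x ∈ O → ∀ s ∈ S, s ∈ O → Ag n y (f s) := by
    intro x hx
    have h1 : ∀ n, ∃ O, Pr n O ∧ x ∈ O := fun n => by
      obtain ⟨O, hO, hxO⟩ := mem_iInter.1 hx.2 n
      exact ⟨O, hO, hxO⟩
    choose O hO hxO using h1
    have h2 : ∀ n, ∃ s ∈ S, s ∈ O n := fun n => by
      obtain ⟨s, h, h'⟩ := mem_closure_iff.1 hx.1 (O n) (hO n).1 (hxO n)
      exact ⟨s, h', h⟩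
    choose s hs hsO using h2
    refine ⟨fun i => f (s (i + 1)) i, fun n O' hO' hxO' t ht htO i hi => ?_⟩
    obtain ⟨r, ⟨h, h'⟩, h''⟩ := mem_closure_iff.1 hx.1 (O (i + 1) ∩ O') ((hO _).1.inter hO'.1)
      ⟨hxO _, hxO'⟩
    change f (s (i + 1)) i = f t i
    rw [(hO (i + 1)).2 _ (hs _) r h'' (hsO _) h i (Nat.lt_succ_self i)]
    exact hO'.2 r h'' t ht h' htO i hi
  choose! φ hφ using hG
  have hSG : S ⊆ G := by
    intro s hs
    refine ⟨subset_closure hs, mem_iInter.2 fun n => ?_⟩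
    have := continuousWithinAt_iff_ag.1 (hf s hs) n
    obtain ⟨O, h, hO, hsO⟩ := eventually_nhds_iff.1 (eventually_nhdsWithin_iff.1 this)
    exact ⟨O, ⟨hO, fun a ha b hb haO hbO => (h a haO ha).symm.trans (h b hbO hb)⟩, hsO⟩
  refine ⟨G, φ, ?_, hSG, inter_subset_left, ?_, ?_⟩
  · refine (isGδ_closed isClosed_closure).inter (IsGδ.iInter_of_isOpen fun n => ?_)
    exact isOpen_sUnion fun O hO => hO.1
  · intro x hx
    rw [continuousWithinAt_iff_ag]
    intro n
    obtain ⟨O, hO, hxO⟩ := mem_iInter.1 hx.2 n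
    rw [eventually_nhdsWithin_iff]
    filter_upwards [hO.1.mem_nhds hxO] with z hz hzG
    obtain ⟨r, h, h'⟩ := mem_closure_iff.1 hzG.1 O hO.1 hz
    exact (hφ x hx n O hO hxO r h' h).trans (hφ z hzG n O hO hz r h' h).symm
  · intro s hs
    refine eq_of_ag fun n => ?_
    obtain ⟨O, hO, hxO⟩ := mem_iInter.1 (hSG hs).2 n
    exact hφ s (hSG hs) n O hO hxO s hs hxO

/-- The theorem of Lavrentiev. -/
theorem lavrentiev [Nonempty T] [Nonempty T'] (S : Set (ℕ → T)) (S' : Set (ℕ → T')) (f : S ≃ₜ S') :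
    ∃ E : GH (ℕ → T) (ℕ → T'), S ⊆ E.e.source ∧ S' ⊆ E.e.target ∧
      (∀ s : S, E.e s = f s) ∧ E.e.target ⊆ closure S' := by
  classical
  let d : ℕ → T := fun _ => Classical.arbitrary T
  let d' : ℕ → T' := fun _ => Classical.arbitrary T'
  let F : (ℕ → T) → (ℕ → T') := fun x => if h : x ∈ S then f ⟨x, h⟩ else d'
  let F' : (ℕ → T') → (ℕ → T) := fun x => if h : x ∈ S' then f.symm ⟨x, h⟩ else d
  have hF : ∀ s : S, F s = f s := fun s => by simp [F]
  have hF' : ∀ s : S', F' s = f.symm s := fun s => by simp [F']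
  have cF : ContinuousOn F S := by
    rw [continuousOn_iff_continuous_domRestrict]
    have : S.domRestrict F = fun s => (f s : ℕ → T') := funext hF
    rw [this]; fun_prop
  have cF' : ContinuousOn F' S' := by
    rw [continuousOn_iff_continuous_domRestrict]
    have : S'.domRestrict F' = fun s => (f.symm s : ℕ → T) := funext hF'
    rw [this]; fun_prop
  obtain ⟨G, φ, hG, hSG, hGc, hφ, hφS⟩ := extend_Gδ S F cF
  obtain ⟨G', φ', hG', hSG', hGc', hφ', hφS'⟩ := extend_Gδ S' F' cF'
  have k1 : ∀ s : S, φ s = f s := fun s => (hφS s s.2).trans (hF s)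
  have k2 : ∀ s : S', φ' s = f.symm s := fun s => (hφS' s s.2).trans (hF' s)
  let e : PartialEquiv (ℕ → T) (ℕ → T') :=
    { toFun := φ
      invFun := φ'
      source := (G ∩ φ ⁻¹' G') ∩ {x | φ' (φ x) = x}
      target := (G' ∩ φ' ⁻¹' G) ∩ {x | φ (φ' x) = x}
      map_source' := by
        rintro x ⟨⟨h1, h2⟩, h3⟩
        refine ⟨⟨h2, ?_⟩, ?_⟩
        · change φ' (φ x) ∈ G; rwa [h3]
        · change φ (φ' (φ x)) = φ x; rw [h3]
      map_target' := by
        rintro x ⟨⟨h1, h2⟩, h3⟩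
        refine ⟨⟨h2, ?_⟩, ?_⟩
        · change φ (φ' x) ∈ G'; rwa [h3]
        · change φ' (φ (φ' x)) = φ' x; rw [h3]
      left_inv' := fun x h => h.2
      right_inv' := fun x h => h.2 }
  refine ⟨⟨e, hφ.mono fun x h => h.1.1, hφ'.mono fun x h => h.1.1, ?_, ?_⟩, ?_, ?_, k1,
    fun x h => hGc' h.1.1⟩
  · exact isGδ_fixed (isGδ_inter_preimage hG hφ hG')
      (hφ'.comp (hφ.mono inter_subset_left) fun x h => h.2)
  · exact isGδ_fixed (isGδ_inter_preimage hG' hφ' hG)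
      (hφ.comp (hφ'.mono inter_subset_left) fun x h => h.2)
  · intro s hs
    have := k1 ⟨s, hs⟩
    refine ⟨⟨hSG hs, ?_⟩, ?_⟩
    · change φ s ∈ G'; rw [this]; exact hSG' (f ⟨s, hs⟩).2
    · change φ' (φ s) = s
      rw [this, k2]; simp
  · intro s hs
    have := k2 ⟨s, hs⟩
    refine ⟨⟨hSG' hs, ?_⟩, ?_⟩
    · change φ' s ∈ G; rw [this]; exact hSG (f.symm ⟨s, hs⟩).2
    · change φ (φ' s) = s
      rw [this, k1]; simp

end Lav
end DH

namespace DH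

section KR
variable {T : Type u}

/-- `U` depends only on the first `n` coordinates. -/
def Det (n : ℕ) (U : Set (ℕ → T)) : Prop := ∀ x y, Ag n x y → x ∈ U → y ∈ U

theorem Det.mono {n m : ℕ} {U : Set (ℕ → T)} (h : Det n U) (hm : n ≤ m) : Det m U :=
  fun x y hxy hx => h x y (hxy.mono hm) hx

/-- Isolated pairs of a relation. -/
def Sing (R : (ℕ → T) → (ℕ → T) → Prop) (x y : ℕ → T) : Prop :=
  R x y ∧ (∀ y', R x y' → y' = y) ∧ (∀ x', R x' y → x' = x)

/-- `x` lies in a box of the relation. -/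
def BoxAt (R : (ℕ → T) → (ℕ → T) → Prop) (N : ℕ) (x : ℕ → T) : Prop :=
  ∃ (U V : Set (ℕ → T)) (n : ℕ), Det n U ∧ Det n V ∧ x ∈ U ∧ V.Nonempty ∧
    (∀ x' ∈ U, ∀ y', R x' y' ↔ y' ∈ V) ∧ (∀ y' ∈ V, ∀ x', R x' y' ↔ x' ∈ U) ∧
    (∀ a ∈ U, ∀ b ∈ U, Ag N a b) ∧ (∀ a ∈ V, ∀ b ∈ V, Ag N a b)

/-- One half of the conditions on a stage of the back-and-forth construction. -/
structure Half (R : (ℕ → T) → (ℕ → T) → Prop) (Y1 Y2 : Set (ℕ → T)) (N : ℕ)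
    (U Z : Set (ℕ → T)) : Prop where
  usc : ∀ x ∈ U, ∀ n, ∃ m, ∀ x' ∈ U, Ag m x x' → ∀ y', R x' y' → ∃ y, R x y ∧ Ag n y y'
  typ : ∀ x ∈ U, (∃ y, Sing R x y ∧ (x ∈ Y1 ↔ y ∈ Y2)) ∨ BoxAt R N x
  cov : ∀ x ∈ U, x ∈ Z → ∃ y, Sing R x y

/-- first index of a point outside `F` -/
def idx (m : (ℕ → T) → ℕ) (N : ℕ) (x : ℕ → T) : List T := PiNat.res x (max (m x + 1) N)

/-- `m` measures the agreement with `F`. -/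
def IsM (F : Set (ℕ → T)) (m : (ℕ → T) → ℕ) : Prop :=
  ∀ x, x ∉ F → ∀ k, k ≤ m x ↔ ∃ f ∈ F, Ag k x f

theorem idx_congr {F : Set (ℕ → T)} {m : (ℕ → T) → ℕ} (hm : IsM F m) {N : ℕ} {x y : ℕ → T}
    (hx : x ∉ F) (h : Ag (max (m x + 1) N) x y) : y ∉ F ∧ m y = m x ∧ idx m N y = idx m N x := by
  have hy : y ∉ F := fun hy =>
    absurd ((hm x hx (m x + 1)).2 ⟨y, hy, h.mono (le_max_left _ _)⟩) (by omega)
  have h1 : m y = m x := by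
    apply le_antisymm
    · by_contra hlt
      push Not at hlt
      obtain ⟨f, hf, h'⟩ := (hm y hy (m x + 1)).1 hlt
      have := (hm x hx (m x + 1)).2 ⟨f, hf, (h.mono (le_max_left _ _)).trans h'⟩
      omega
    · obtain ⟨f, hf, h'⟩ := (hm x hx (m x)).1 le_rfl
      exact (hm y hy (m x)).2 ⟨f, hf, (h.mono (by omega)).symm.trans h'⟩
  refine ⟨hy, h1, ?_⟩
  unfold idx
  rw [h1]
  exact (ag_iff_res.1 h).symm

theorem idx_length (m : (ℕ → T) → ℕ) (N : ℕ) (x : ℕ → T) :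
    (idx m N x).length = max (m x + 1) N := PiNat.res_length _ _

theorem idx_eq {F : Set (ℕ → T)} {m : (ℕ → T) → ℕ} (hm : IsM F m) {N : ℕ} {x y : ℕ → T}
    (hx : x ∉ F) (h : idx m N x = idx m N y) :
    Ag (max (m x + 1) N) x y ∧ m y = m x := by
  have hl := congrArg List.length h
  rw [idx_length, idx_length] at hl
  have h1 : Ag (max (m x + 1) N) x y := by
    rw [ag_iff_res]
    unfold idx at h
    rw [h, hl]
  exact ⟨h1, (idx_congr hm hx h1).2.1⟩

theorem res_eq_of_idx {F : Set (ℕ → T)} {m : (ℕ → T) → ℕ} (hm : IsM F m) {N : ℕ} {x y : ℕ → T}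
    (hx : x ∉ F) (h : idx m N x = idx m N y) :
    PiNat.res x (m x) = PiNat.res y (m y) := by
  obtain ⟨h1, h2⟩ := idx_eq hm hx h
  rw [h2]
  exact ag_iff_res.1 (h1.mono (by omega))

/-- Drop the first `n` coordinates. -/
def drop (n : ℕ) (x : ℕ → T) : ℕ → T := fun i => x (n + i)

/-- Replace the tail. -/
def splice (n : ℕ) (x t : ℕ → T) : ℕ → T := fun i => if i < n then x i else t (i - n)

theorem ag_splice (n : ℕ) (x t : ℕ → T) : Ag n x (splice n x t) := fun i hi => by
  simp [splice, hi]

theorem drop_splice (n : ℕ) (x t : ℕ → T) : drop n (splice n x t) = t := by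
  funext i; simp [splice, drop]

theorem Ag.drop {n m : ℕ} {x y : ℕ → T} (h : Ag (n + m) x y) : Ag m (DH.drop n x) (DH.drop n y) :=
  fun i hi => h (n + i) (by omega)

/-- Labels. -/
def lab (m : (ℕ → T) → ℕ) (N : ℕ) (τ : List T → (ℕ → T) → Option (List T)) (x : ℕ → T) :
    List T ⊕ List T :=
  match τ (idx m N x) (drop (idx m N x).length x) with
  | none => Sum.inl (idx m N x)
  | some j => Sum.inr j

theorem lab_cases (m : (ℕ → T) → ℕ) (N : ℕ) (τ : List T → (ℕ → T) → Option (List T)) (x : ℕ → T) :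
    (τ (idx m N x) (drop (idx m N x).length x) = none ∧ lab m N τ x = Sum.inl (idx m N x)) ∨
    ∃ j, τ (idx m N x) (drop (idx m N x).length x) = some j ∧ lab m N τ x = Sum.inr j := by
  unfold lab
  cases h : τ (idx m N x) (drop (idx m N x).length x) with
  | none => left; simp
  | some j => right; exact ⟨j, rfl, rfl⟩

/-- Data for the Knaster–Reichbach construction. -/
structure KRD (T : Type u) (N : ℕ) where
  (F U F' V : Set (ℕ → T))
  (m m' : (ℕ → T) → ℕ)
  (g g' : (ℕ → T) → (ℕ → T))
  (A Yp Bp Xp : List T → (ℕ → T))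
  (L L' : List T → ℕ)
  (τ τ' : List T → (ℕ → T) → Option (List T))
  dU : Det N U
  dV : Det N V
  FU : F ⊆ U
  FV : F' ⊆ V
  hm : IsM F m
  hm' : IsM F' m'
  gF : ∀ x ∈ F, g x ∈ F'
  gF' : ∀ x ∈ F', g' x ∈ F
  gg : ∀ x ∈ F, g' (g x) = x
  gg' : ∀ x ∈ F', g (g' x) = x
  hg : ∀ x ∈ F, ∀ n, ∃ p, ∀ x1 ∈ F, Ag p x x1 → Ag n (g x) (g x1)
  hg' : ∀ x ∈ F', ∀ n, ∃ p, ∀ x1 ∈ F', Ag p x x1 → Ag n (g' x) (g' x1)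
  hA : ∀ x, x ∉ F → A (PiNat.res x (m x)) ∈ V ∧ A (PiNat.res x (m x)) ∉ F' ∧
    Yp (PiNat.res x (m x)) ∈ F' ∧ m x ≤ m' (A (PiNat.res x (m x))) ∧
    Ag (m' (A (PiNat.res x (m x)))) (A (PiNat.res x (m x))) (Yp (PiNat.res x (m x))) ∧
    Ag (m x) (g' (Yp (PiNat.res x (m x)))) x
  hB : ∀ x, x ∉ F' → Bp (PiNat.res x (m' x)) ∈ U ∧ Bp (PiNat.res x (m' x)) ∉ F ∧
    Xp (PiNat.res x (m' x)) ∈ F ∧ m' x ≤ m (Bp (PiNat.res x (m' x))) ∧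
    Ag (m (Bp (PiNat.res x (m' x)))) (Bp (PiNat.res x (m' x))) (Xp (PiNat.res x (m' x))) ∧
    Ag (m' x) (g (Xp (PiNat.res x (m' x)))) x
  τ1 : ∀ i t j, τ i t = some j → ∃ y ∈ V, y ∉ F' ∧ idx m' N y = j ∧
    idx m N (Bp (PiNat.res y (m' y))) = i
  τ2 : ∀ y ∈ V, y ∉ F' →
    ∃ t, τ (idx m N (Bp (PiNat.res y (m' y)))) t = some (idx m' N y)
  τ3 : ∀ i, ∃ t, τ i t = none
  τ4 : ∀ i t t', Ag (L i) t t' → τ i t = τ i t'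
  τ1' : ∀ i t j, τ' i t = some j → ∃ y ∈ U, y ∉ F ∧ idx m N y = j ∧
    idx m' N (A (PiNat.res y (m y))) = i
  τ2' : ∀ y ∈ U, y ∉ F →
    ∃ t, τ' (idx m' N (A (PiNat.res y (m y)))) t = some (idx m N y)
  τ3' : ∀ i, ∃ t, τ' i t = none
  τ4' : ∀ i t t', Ag (L' i) t t' → τ' i t = τ' i t'

/-- Exchange of the two sides. -/
def KRD.swap {N : ℕ} (D : KRD T N) : KRD T N where
  F := D.F'
  U := D.V
  F' := D.F
  V := D.U
  m := D.m'
  m' := D.m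
  g := D.g'
  g' := D.g
  A := D.Bp
  Yp := D.Xp
  Bp := D.A
  Xp := D.Yp
  L := D.L'
  L' := D.L
  τ := D.τ'
  τ' := D.τ
  dU := D.dV
  dV := D.dU
  FU := D.FV
  FV := D.FU
  hm := D.hm'
  hm' := D.hm
  gF := D.gF'
  gF' := D.gF
  gg := D.gg'
  gg' := D.gg
  hg := D.hg'
  hg' := D.hg
  hA := D.hB
  hB := D.hA
  τ1 := D.τ1'
  τ2 := D.τ2'
  τ3 := D.τ3'
  τ4 := D.τ4'
  τ1' := D.τ1
  τ2' := D.τ2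
  τ3' := D.τ3
  τ4' := D.τ4

/-- The relation of the data. -/
def KRD.R {N : ℕ} (D : KRD T N) (x y : ℕ → T) : Prop :=
  (x ∈ D.F ∧ y ∈ D.F' ∧ y = D.g x) ∨ (x ∈ D.U ∧ x ∉ D.F ∧ y ∈ D.V ∧ y ∉ D.F' ∧
    lab D.m N D.τ x = (lab D.m' N D.τ' y).swap)

theorem KRD.R_swap {N : ℕ} (D : KRD T N) (x y : ℕ → T) : D.swap.R x y ↔ D.R y x := by
  unfold KRD.R
  constructor
  · rintro (⟨h1, h2, h3⟩ | ⟨h1, h2, h3, h4, h5⟩)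
    · refine Or.inl ⟨h2, h1, ?_⟩
      have : y = D.g' x := h3
      rw [this]; exact (D.gg' x h1).symm
    · refine Or.inr ⟨h3, h4, h1, h2, ?_⟩
      have : lab D.m' N D.τ' x = (lab D.m N D.τ y).swap := h5
      rw [this, Sum.swap_swap]
  · rintro (⟨h1, h2, h3⟩ | ⟨h1, h2, h3, h4, h5⟩)
    · refine Or.inl ⟨h2, h1, ?_⟩
      change y = D.g' x
      rw [h3]; exact (D.gg y h1).symm
    · refine Or.inr ⟨h3, h4, h1, h2, ?_⟩
      change lab D.m' N D.τ' x = (lab D.m N D.τ y).swap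
      rw [h5, Sum.swap_swap]

theorem KRD.R_idx {N : ℕ} (D : KRD T N) {x y : ℕ → T} (h : D.R x y) (hx : x ∉ D.F) :
    x ∈ D.U ∧ y ∈ D.V ∧ y ∉ D.F' ∧
    (idx D.m' N y = idx D.m' N (D.A (PiNat.res x (D.m x))) ∨
      idx D.m N x = idx D.m N (D.Bp (PiNat.res y (D.m' y)))) := by
  rcases h with ⟨h1, -⟩ | ⟨h1, h2, h3, h4, h5⟩
  · exact absurd h1 hx
  refine ⟨h1, h3, h4, ?_⟩
  rcases lab_cases D.m N D.τ x with ⟨a1, a2⟩ | ⟨j, a1, a2⟩ <;>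
  rcases lab_cases D.m' N D.τ' y with ⟨b1, b2⟩ | ⟨j', b1, b2⟩
  · rw [a2, b2] at h5; simp at h5
  · left
    rw [a2, b2] at h5
    simp only [Sum.swap_inr, Sum.inl.injEq] at h5
    obtain ⟨z, hzU, hzF, hz1, hz2⟩ := D.τ1' _ _ _ b1
    rw [← hz2, res_eq_of_idx D.hm hx (h5.trans hz1.symm)]
  · right
    rw [a2, b2] at h5
    simp only [Sum.swap_inl, Sum.inr.injEq] at h5
    obtain ⟨z, hzU, hzF, hz1, hz2⟩ := D.τ1 _ _ _ a1
    rw [← hz2, res_eq_of_idx D.hm' hzF (hz1.trans h5)]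
  · rw [a2, b2] at h5; simp at h5

theorem KRD.usc {N : ℕ} (D : KRD T N) {x : ℕ → T} (hx : x ∈ D.F) (n : ℕ) :
    ∃ p, ∀ x', Ag p x x' → ∀ y', D.R x' y' → Ag n (D.g x) y' := by
  obtain ⟨p, hp⟩ := D.hg x hx n
  let q := (Finset.range n).sup fun k => D.m (D.Bp (PiNat.res (D.g x) k)) + 1
  refine ⟨max (max p n) q, fun x' hxx y' hR => ?_⟩
  by_cases hx' : x' ∈ D.F
  · rcases hR with ⟨h1, h2, h3⟩ | ⟨h1, h2, h3, h4, h5⟩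
    · rw [h3]; exact hp _ hx' (hxx.mono (by simp))
    · exact absurd hx' h2
  obtain ⟨hU, hV, hF', hc⟩ := D.R_idx hR hx'
  have hM : max (max p n) q ≤ D.m x' := (D.hm x' hx' _).2 ⟨x, hx, hxx.symm⟩
  rcases hc with hc | hc
  · obtain ⟨a1, a2, a3, a4, a5, a6⟩ := D.hA x' hx'
    set s := PiNat.res x' (D.m x')
    have h1 : Ag n (D.g x) (D.g (D.g' (D.Yp s))) :=
      hp _ (D.gF' _ a3) ((hxx.trans (a6.mono hM).symm).mono (by simp))
    rw [D.gg' _ a3] at h1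
    have h2 := (idx_eq D.hm' a2 hc.symm).1
    have hn : n ≤ D.m' (D.A s) := le_trans (by simp) (hM.trans a4)
    exact (h1.trans (a5.mono hn).symm).trans (h2.mono (by omega))
  · obtain ⟨b1, b2, b3, b4, b5, b6⟩ := D.hB y' hF'
    set s := PiNat.res y' (D.m' y') with hs
    obtain ⟨h2, h3⟩ := idx_eq D.hm hx' hc
    rw [h3] at b5
    have h4 : Ag (D.m x') x' (D.Xp s) := (h2.mono (by omega)).trans b5
    have h1 : Ag n (D.g x) (D.g (D.Xp s)) :=
      hp _ b3 ((hxx.trans (h4.mono hM)).mono (by simp))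
    by_cases hn : n ≤ D.m' y'
    · exact h1.trans (b6.mono hn)
    · exfalso
      push Not at hn
      have h5 : s = PiNat.res (D.g x) (D.m' y') :=
        (ag_iff_res.1 ((h1.mono hn.le).trans b6)).symm
      have h6 : D.m (D.Bp (PiNat.res (D.g x) (D.m' y'))) + 1 ≤ q :=
        Finset.le_sup (f := fun k => D.m (D.Bp (PiNat.res (D.g x) k)) + 1)
          (Finset.mem_range.2 hn)
      rw [← h5, h3] at h6
      have : q ≤ D.m x' := le_trans (le_max_right _ _) hM
      omega

theorem KRD.exists_partner {N : ℕ} (D : KRD T N) {x : ℕ → T} (hU : x ∈ D.U) (hx : x ∉ D.F) :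
    ∃ y ∈ D.V, y ∉ D.F' ∧ lab D.m N D.τ x = (lab D.m' N D.τ' y).swap := by
  have key : ∀ a ∈ D.V, a ∉ D.F' → ∀ t, ∃ y ∈ D.V, y ∉ D.F' ∧ idx D.m' N y = idx D.m' N a ∧
      drop (idx D.m' N y).length y = t := by
    intro a ha haF t
    have h := ag_splice (max (D.m' a + 1) N) a t
    obtain ⟨h1, h2, h3⟩ := idx_congr D.hm' haF h
    refine ⟨_, D.dV _ _ (h.mono (le_max_right _ _)) ha, h1, h3, ?_⟩
    rw [h3, idx_length, drop_splice]
  rcases lab_cases D.m N D.τ x with ⟨a1, a2⟩ | ⟨j, a1, a2⟩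
  · obtain ⟨c1, c2, c3, c4, c5, c6⟩ := D.hA x hx
    obtain ⟨t, ht⟩ := D.τ2' x hU hx
    obtain ⟨y, h1, h2, h3, h4⟩ := key _ c1 c2 t
    refine ⟨y, h1, h2, ?_⟩
    rcases lab_cases D.m' N D.τ' y with ⟨b1, b2⟩ | ⟨j', b1, b2⟩
    · rw [h4, h3, ht] at b1; simp at b1
    · rw [h4, h3, ht] at b1
      rw [a2, b2]
      simpa using b1
  · obtain ⟨y0, c1, c2, c3, c4⟩ := D.τ1 _ _ _ a1
    obtain ⟨t, ht⟩ := D.τ3' j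
    obtain ⟨y, h1, h2, h3, h4⟩ := key _ c1 c2 t
    refine ⟨y, h1, h2, ?_⟩
    rcases lab_cases D.m' N D.τ' y with ⟨b1, b2⟩ | ⟨j', b1, b2⟩
    · rw [a2, b2, h3, c3]; rfl
    · rw [h4, h3, c3, ht] at b1; simp at b1

theorem KRD.idx_of_lab {N : ℕ} (D : KRD T N) {x x' : ℕ → T}
    (h : lab D.m N D.τ x = lab D.m N D.τ x') : idx D.m N x = idx D.m N x' := by
  rcases lab_cases D.m N D.τ x with ⟨a1, a2⟩ | ⟨j, a1, a2⟩ <;>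
  rcases lab_cases D.m N D.τ x' with ⟨b1, b2⟩ | ⟨j', b1, b2⟩
  · rw [a2, b2] at h; simpa using h
  · rw [a2, b2] at h; simp at h
  · rw [a2, b2] at h; simp at h
  · rw [a2, b2] at h
    simp only [Sum.inr.injEq] at h
    obtain ⟨y0, c1, c2, c3, c4⟩ := D.τ1 _ _ _ a1
    obtain ⟨y1, d1, d2, d3, d4⟩ := D.τ1 _ _ _ b1
    rw [← c4, ← d4, res_eq_of_idx D.hm' c2 (c3.trans (h.trans d3.symm))]

/-- A block of the partition. -/
def KRD.blk {N : ℕ} (D : KRD T N) (l : List T ⊕ List T) : Set (ℕ → T) :=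
  {x | x ∈ D.U ∧ x ∉ D.F ∧ lab D.m N D.τ x = l}

theorem KRD.blk_ag {N : ℕ} (D : KRD T N) (l : List T ⊕ List T) :
    ∀ a ∈ D.blk l, ∀ b ∈ D.blk l, Ag N a b := by
  rintro a ⟨h1, h2, h3⟩ b ⟨h4, h5, h6⟩
  exact (idx_eq D.hm h2 (D.idx_of_lab (h3.trans h6.symm))).1.mono (le_max_right _ _)

theorem KRD.blk_det {N : ℕ} (D : KRD T N) (l : List T ⊕ List T) : ∃ n, Det n (D.blk l) := by
  by_cases hne : (D.blk l).Nonempty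
  · obtain ⟨a, ha⟩ := hne
    refine ⟨(idx D.m N a).length + D.L (idx D.m N a), ?_⟩
    rintro x y hxy ⟨h1, h2, h3⟩
    have hi : idx D.m N x = idx D.m N a := D.idx_of_lab (h3.trans ha.2.2.symm)
    rw [← hi] at hxy
    have h := hxy.mono (Nat.le_add_right _ _)
    rw [idx_length] at h
    obtain ⟨k1, k2, k3⟩ := idx_congr D.hm h2 h
    refine ⟨D.dU _ _ (h.mono (le_max_right _ _)) h1, k1, ?_⟩
    rw [← h3]
    unfold lab
    rw [k3, D.τ4 _ _ _ hxy.drop]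
  · refine ⟨0, fun x y _ hx => absurd ⟨x, hx⟩ hne⟩

theorem KRD.boxAt {N : ℕ} (D : KRD T N) {x : ℕ → T} (hU : x ∈ D.U) (hx : x ∉ D.F) :
    BoxAt D.R N x := by
  obtain ⟨n1, hn1⟩ := D.blk_det (lab D.m N D.τ x)
  obtain ⟨n2, hn2⟩ := D.swap.blk_det (lab D.m N D.τ x).swap
  refine ⟨D.blk (lab D.m N D.τ x), D.swap.blk (lab D.m N D.τ x).swap, max n1 n2,
    hn1.mono (le_max_left _ _), hn2.mono (le_max_right _ _), ⟨hU, hx, rfl⟩, ?_, ?_, ?_,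
    D.blk_ag _, D.swap.blk_ag _⟩
  · obtain ⟨y, h1, h2, h3⟩ := D.exists_partner hU hx
    refine ⟨y, h1, h2, ?_⟩
    rw [h3, Sum.swap_swap]; rfl
  · rintro x' ⟨h1, h2, h3⟩ y'
    constructor
    · rintro (⟨k1, -⟩ | ⟨k1, k2, k3, k4, k5⟩)
      · exact absurd k1 h2
      · refine ⟨k3, k4, ?_⟩
        rw [← h3, k5, Sum.swap_swap]; rfl
    · rintro ⟨k1, k2, k3⟩
      refine Or.inr ⟨h1, h2, k1, k2, ?_⟩
      have : lab D.m' N D.τ' y' = (lab D.m N D.τ x).swap := k3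
      rw [this, Sum.swap_swap, h3]
  · rintro y' ⟨h1, h2, h3⟩ x'
    have h3' : lab D.m' N D.τ' y' = (lab D.m N D.τ x).swap := h3
    constructor
    · rintro (⟨-, k1, -⟩ | ⟨k1, k2, k3, k4, k5⟩)
      · exact absurd k1 h2
      · refine ⟨k1, k2, ?_⟩
        rw [k5, h3', Sum.swap_swap]
    · rintro ⟨k1, k2, k3⟩
      refine Or.inr ⟨k1, k2, h1, h2, ?_⟩
      rw [h3', Sum.swap_swap, k3]

theorem KRD.sing {N : ℕ} (D : KRD T N) {x : ℕ → T} (hx : x ∈ D.F) : Sing D.R x (D.g x) := by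
  refine ⟨Or.inl ⟨hx, D.gF x hx, rfl⟩, ?_, ?_⟩
  · rintro y (⟨k1, k2, k3⟩ | ⟨k1, k2, k3, k4, k5⟩)
    · exact k3
    · exact absurd hx k2
  · rintro y (⟨k1, k2, k3⟩ | ⟨k1, k2, k3, k4, k5⟩)
    · rw [← D.gg x hx, k3, D.gg y k1]
    · exact absurd (D.gF x hx) k4

theorem BoxAt.usc {R : (ℕ → T) → (ℕ → T) → Prop} {N : ℕ} {x : ℕ → T} (h : BoxAt R N x) (n : ℕ) :
    ∃ m, ∀ x', Ag m x x' → ∀ y', R x' y' → ∃ y, R x y ∧ Ag n y y' := by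
  obtain ⟨U, V, k, h1, h2, h3, h4, h5, h6, h7⟩ := h
  refine ⟨k, fun x' hx y' hR => ⟨y', ?_, Ag.refl _ _⟩⟩
  rw [h5 x h3]
  exact (h5 x' (h1 _ _ hx h3) y').1 hR

theorem KRD.half {N : ℕ} (D : KRD T N) (Y1 Y2 : Set (ℕ → T))
    (hY : ∀ x ∈ D.F, (x ∈ Y1 ↔ D.g x ∈ Y2)) : Half D.R Y1 Y2 N D.U D.F := by
  refine ⟨?_, ?_, fun x _ hx => ⟨_, D.sing hx⟩⟩
  · intro x hxU n
    by_cases hx : x ∈ D.F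
    · obtain ⟨p, hp⟩ := D.usc hx n
      exact ⟨p, fun x' _ h y' hR => ⟨D.g x, (D.sing hx).1, hp x' h y' hR⟩⟩
    · obtain ⟨p, hp⟩ := (D.boxAt hxU hx).usc n
      exact ⟨p, fun x' _ h y' hR => hp x' h y' hR⟩
  · intro x hxU
    by_cases hx : x ∈ D.F
    · exact Or.inl ⟨_, D.sing hx, hY x hx⟩
    · exact Or.inr (D.boxAt hxU hx)

end KR
end DH

namespace DH

section KR2
variable {T : Type u}

theorem exists_isM [TopologicalSpace T] [DiscreteTopology T] {F : Set (ℕ → T)} (hF : IsClosed F)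
    (hne : F.Nonempty) : ∃ m, IsM F m := by
  classical
  have h : ∀ x, x ∉ F → ∃ n, ¬ ∃ f ∈ F, Ag n x f := by
    intro x hx
    by_contra hc
    push Not at hc
    exact hx (hF.closure_eq ▸ mem_closure_iff_ag.2 hc)
  choose! M hM using h
  have key : ∀ x, x ∉ F → ∃ m, ∀ k, k ≤ m ↔ ∃ f ∈ F, Ag k x f := by
    intro x hx
    have hex : ∃ n, ¬ ∃ f ∈ F, Ag n x f := ⟨_, hM x hx⟩
    have hpos : Nat.find hex ≠ 0 := by
      intro h0
      have := Nat.find_spec hex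
      rw [h0] at this
      obtain ⟨f, hf⟩ := hne
      exact this ⟨f, hf, Ag.zero _ _⟩
    refine ⟨Nat.find hex - 1, fun k => ⟨fun hk => ?_, fun ⟨f, hf, hk⟩ => ?_⟩⟩
    · have := Nat.find_min hex (m := k) (by omega)
      simpa using this
    · by_contra hlt
      exact Nat.find_spec hex ⟨f, hf, hk.mono (by omega)⟩
  choose! m hm using key
  exact ⟨m, hm⟩

theorem near_aux [Nonempty T] {F F' U : Set (ℕ → T)} {D : ℕ} (dU : Det D U) (FU : F ⊆ U)
    {m : (ℕ → T) → ℕ} (hm : IsM F m) {g g' : (ℕ → T) → (ℕ → T)}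
    (gF' : ∀ x ∈ F', g' x ∈ F) (gg' : ∀ x ∈ F', g (g' x) = x)
    (hg : ∀ x ∈ F, ∀ n, ∃ p, ∀ x1 ∈ F, Ag p x x1 → Ag n (g x) (g x1))
    (nd : ∀ x ∈ F, ∀ n, ∃ b, b ∉ F ∧ Ag n x b) :
    ∃ Bp Xp : List T → (ℕ → T), ∀ s, (∃ y0 ∈ F', PiNat.res y0 s.length = s) →
      Bp s ∈ U ∧ Bp s ∉ F ∧ Xp s ∈ F ∧ s.length ≤ m (Bp s) ∧ Ag (m (Bp s)) (Bp s) (Xp s) ∧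
        PiNat.res (g (Xp s)) s.length = s := by
  have : ∀ s : List T, ∃ b x1 : ℕ → T, (∃ y0 ∈ F', PiNat.res y0 s.length = s) →
      b ∈ U ∧ b ∉ F ∧ x1 ∈ F ∧ s.length ≤ m b ∧ Ag (m b) b x1 ∧
        PiNat.res (g x1) s.length = s := by
    intro s
    by_cases h : ∃ y0 ∈ F', PiNat.res y0 s.length = s
    · obtain ⟨y0, hy, hs⟩ := h
      obtain ⟨p, hp⟩ := hg _ (gF' _ hy) s.length
      obtain ⟨b, hb, hab⟩ := nd _ (gF' _ hy) (max (max p s.length) D)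
      have h1 : max (max p s.length) D ≤ m b := (hm b hb _).2 ⟨_, gF' _ hy, hab.symm⟩
      obtain ⟨x1, hx1, h2⟩ := (hm b hb (m b)).1 le_rfl
      refine ⟨b, x1, fun _ => ⟨dU _ _ (hab.mono (by simp)) (FU (gF' _ hy)), hb, hx1,
        le_trans (by simp) h1, h2, ?_⟩⟩
      have h3 := hp x1 hx1 ((hab.trans (h2.mono h1)).mono (by simp))
      rw [gg' _ hy, ag_iff_res] at h3
      rw [← h3, hs]
    · exact ⟨Classical.arbitrary _, Classical.arbitrary _, fun h' => absurd h' h⟩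
  choose Bp Xp h using this
  exact ⟨Bp, Xp, h⟩

theorem exists_tau [Nontrivial T] (S : Set (List T)) (hS : Finite T → S.Finite) :
    ∃ (L : ℕ) (τ : (ℕ → T) → Option (List T)), (∀ t j, τ t = some j → j ∈ S) ∧
      (∀ j ∈ S, ∃ t, τ t = some j) ∧ (∃ t, τ t = none) ∧ ∀ t t', Ag L t t' → τ t = τ t' := by
  have h1 : ∃ (L : ℕ) (ι : Option S → (Fin L → T)), Function.Injective ι := by
    by_cases hT : Finite T
    · have := (hS hT).to_subtype
      have := Fintype.ofFinite T
      have := Fintype.ofFinite S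
      classical
      refine ⟨Fintype.card (Option S), ?_⟩
      have hc : Fintype.card (Option S) ≤ Fintype.card (Fin (Fintype.card (Option S)) → T) := by
        rw [Fintype.card_fun, Fintype.card_fin]
        exact (Nat.lt_pow_self Fintype.one_lt_card).le
      obtain ⟨f⟩ := Function.Embedding.nonempty_of_card_le hc
      exact ⟨f, f.injective⟩
    · rw [not_finite_iff_infinite] at hT
      refine ⟨1, ?_⟩
      have hc : Cardinal.mk (Option S) ≤ Cardinal.mk (Fin 1 → T) := by
        calc Cardinal.mk (Option S) ≤ Cardinal.mk (Option (List T)) :=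
              Cardinal.mk_le_of_injective (Option.map_injective Subtype.val_injective)
          _ = Cardinal.mk (List T) + 1 := Cardinal.mk_option
          _ = Cardinal.mk T + 1 := by rw [Cardinal.mk_list_eq_mk]
          _ = Cardinal.mk T := Cardinal.add_one_eq (Cardinal.aleph0_le_mk T)
          _ = Cardinal.mk (Fin 1 → T) := Cardinal.mk_congr (Equiv.funUnique (Fin 1) T).symm
      obtain ⟨f⟩ := hc
      exact ⟨f, f.injective⟩
  obtain ⟨L, ι, hι⟩ := h1
  have hsurj : ∀ o : Option S, ∃ t : ℕ → T, Function.invFun ι (fun i : Fin L => t i) = o := by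
    intro o
    obtain ⟨a⟩ := (inferInstance : Nonempty T)
    refine ⟨fun i => if h : i < L then ι o ⟨i, h⟩ else a, ?_⟩
    have : (fun i : Fin L => if h : (i : ℕ) < L then ι o ⟨i, h⟩ else a) = ι o := by
      funext i; simp
    rw [this, Function.leftInverse_invFun hι]
  refine ⟨L, fun t => (Function.invFun ι (fun i : Fin L => t i)).map Subtype.val, ?_, ?_, ?_, ?_⟩
  · intro t j h
    simp only [Option.map_eq_some_iff] at h
    obtain ⟨a, -, rfl⟩ := h
    exact a.2
  · intro j hj
    obtain ⟨t, ht⟩ := hsurj (some ⟨j, hj⟩)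
    exact ⟨t, by simp [ht]⟩
  · obtain ⟨t, ht⟩ := hsurj none
    exact ⟨t, by simp [ht]⟩
  · intro t t' h
    have : (fun i : Fin L => t i) = fun i : Fin L => t' i := funext fun i => h i i.2
    simp only [this]


theorem nd_iff [TopologicalSpace T] [DiscreteTopology T] {F : Set (ℕ → T)} :
    interior F = ∅ ↔ ∀ x ∈ F, ∀ n, ∃ b, b ∉ F ∧ Ag n x b := by
  constructor
  · intro h x hx n
    by_contra hc
    push Not at hc
    have : x ∈ interior F := by
      rw [mem_interior_iff_mem_nhds, mem_nhds_iff_ag]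
      exact ⟨n, fun y hy => by_contra fun hF => hc y hF hy⟩
    rw [h] at this
    exact this
  · intro h
    by_contra hc
    obtain ⟨x, hx⟩ := nonempty_iff_ne_empty.2 hc
    obtain ⟨n, hn⟩ := mem_nhds_iff_ag.1 (mem_interior_iff_mem_nhds.1 hx)
    obtain ⟨b, hb, hab⟩ := h x (interior_subset hx) n
    exact hb (hn b hab)

theorem exists_ne_ag [Nontrivial T] (x : ℕ → T) (n : ℕ) : ∃ b, b ≠ x ∧ Ag n x b := by
  obtain ⟨t, ht⟩ := exists_ne (x n)
  refine ⟨Function.update x n t, fun h => ht ?_, fun i hi => ?_⟩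
  · have := congrFun h n
    simpa using this
  · rw [Function.update_of_ne (by omega)]

theorem isOpen_of_det [TopologicalSpace T] [DiscreteTopology T] {n : ℕ} {U : Set (ℕ → T)}
    (h : Det n U) : IsOpen U := by
  rw [isOpen_iff_mem_nhds]
  exact fun x hx => mem_nhds_iff_ag.2 ⟨n, fun y hy => h x y hy hx⟩

/-- The finite-extension step inside one box. -/
theorem box_lemma [Nontrivial T] [TopologicalSpace T] [DiscreteTopology T] (Y1 Y2 : Set (ℕ → T))
    {D N : ℕ} (hDN : D ≤ N) {U V Z : Set (ℕ → T)} (dU : Det D U) (dV : Det D V)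
    (hU : U.Nonempty) (hV : V.Nonempty) (hZ : IsClosed Z) (hZ' : interior Z = ∅)
    (hemb : ∀ W : Set (ℕ → T), IsOpen W → W.Nonempty → ∃ h : (ℕ → T) → (ℕ → T),
      IsClosedEmbedding h ∧ range h ⊆ W ∧ ∀ x, h x ∈ Y2 ↔ x ∈ Y1) :
    ∃ R : (ℕ → T) → (ℕ → T) → Prop, (∀ x y, R x y → x ∈ U ∧ y ∈ V) ∧
      Half R Y1 Y2 N U Z ∧ Half (flip R) Y2 Y1 N V ∅ := by
  classical
  obtain ⟨u0, hu0⟩ := hU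
  obtain ⟨h, hh, hr, hY⟩ := hemb V (isOpen_of_det dV) hV
  have hUc : IsClosed U := by
    rw [← isOpen_compl_iff]
    refine isOpen_of_det (n := D) fun x y hxy hx hy => hx (dU _ _ hxy.symm hy)
  let F : Set (ℕ → T) := (Z ∩ U) ∪ {u0}
  have FU : F ⊆ U := union_subset inter_subset_right (singleton_subset_iff.2 hu0)
  have hF : IsClosed F := (hZ.inter hUc).union isClosed_singleton
  have hFne : F.Nonempty := ⟨u0, Or.inr rfl⟩
  have nd : ∀ x ∈ F, ∀ n, ∃ b, b ∉ F ∧ Ag n x b := by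
    rw [← nd_iff, ← subset_empty_iff]
    have h1 : interior (Z ∪ {u0}) = ∅ := by
      rw [interior_union_isClosed_of_interior_empty hZ]
      · exact hZ'
      · rw [nd_iff]
        intro x hx n
        obtain ⟨b, hb, hab⟩ := exists_ne_ag x n
        exact ⟨b, fun hb' => hb (hb'.trans hx.symm), hab⟩
    rw [← h1]
    exact interior_mono (union_subset_union_left _ inter_subset_left)
  let F' : Set (ℕ → T) := h '' F
  have FV : F' ⊆ V := by
    rintro _ ⟨x, -, rfl⟩; exact hr (mem_range_self x)
  have hF' : IsClosed F' := hh.isClosedMap _ hF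
  have hcont : ∀ x n, ∃ p, ∀ x1, Ag p x x1 → Ag n (h x) (h x1) := by
    intro x n
    obtain ⟨p, hp⟩ := continuousOn_pi_ag (hh.continuous.continuousOn (s := univ)) (mem_univ x) n
    exact ⟨p, fun x1 => hp x1 (mem_univ _)⟩
  have nd' : ∀ x ∈ F', ∀ n, ∃ b, b ∉ F' ∧ Ag n x b := by
    rintro _ ⟨x, hx, rfl⟩ n
    obtain ⟨p, hp⟩ := hcont x n
    obtain ⟨b, hb, hab⟩ := nd x hx p
    refine ⟨h b, ?_, hp b hab⟩
    rintro ⟨b', hb', h'⟩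
    exact hb (hh.injective h' ▸ hb')
  obtain ⟨m, hm⟩ := exists_isM hF hFne
  obtain ⟨m', hm'⟩ := exists_isM hF' (hFne.image h)
  have hinv : ∀ x, Function.invFun h (h x) = x := Function.leftInverse_invFun hh.injective
  let g' := Function.invFun h
  have gF : ∀ x ∈ F, h x ∈ F' := fun x hx => mem_image_of_mem _ hx
  have gF' : ∀ x ∈ F', g' x ∈ F := by
    rintro _ ⟨x, hx, rfl⟩
    change Function.invFun h (h x) ∈ F
    rwa [hinv]
  have gg : ∀ x ∈ F, g' (h x) = x := fun x _ => hinv x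
  have gg' : ∀ x ∈ F', h (g' x) = x := by
    rintro _ ⟨x, hx, rfl⟩
    change h (Function.invFun h (h x)) = h x
    rw [hinv]
  have hg : ∀ x ∈ F, ∀ n, ∃ p, ∀ x1 ∈ F, Ag p x x1 → Ag n (h x) (h x1) := by
    intro x _ n
    obtain ⟨p, hp⟩ := hcont x n
    exact ⟨p, fun x1 _ => hp x1⟩
  have hg' : ∀ x ∈ F', ∀ n, ∃ p, ∀ x1 ∈ F', Ag p x x1 → Ag n (g' x) (g' x1) := by
    rintro _ ⟨x, hx, rfl⟩ n
    have : {y | Ag n x y} ∈ 𝓝 x := (isOpen_ag n x).mem_nhds (Ag.refl n x)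
    rw [hh.isInducing.nhds_eq_comap, mem_comap] at this
    obtain ⟨t, ht, hts⟩ := this
    obtain ⟨p, hp⟩ := mem_nhds_iff_ag.1 ht
    refine ⟨p, ?_⟩
    rintro _ ⟨x1, hx1, rfl⟩ hag
    change Ag n (Function.invFun h (h x)) (Function.invFun h (h x1))
    rw [hinv, hinv]
    exact hts (hp _ hag)
  obtain ⟨Bp, Xp, hB⟩ := near_aux dU FU hm gF' gg' hg nd
  obtain ⟨A, Yp, hA⟩ := near_aux (F' := F) dV FV hm' gF gg hg' nd'
  have hB' : ∀ x, x ∉ F' → Bp (PiNat.res x (m' x)) ∈ U ∧ Bp (PiNat.res x (m' x)) ∉ F ∧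
    Xp (PiNat.res x (m' x)) ∈ F ∧ m' x ≤ m (Bp (PiNat.res x (m' x))) ∧
    Ag (m (Bp (PiNat.res x (m' x)))) (Bp (PiNat.res x (m' x))) (Xp (PiNat.res x (m' x))) ∧
    Ag (m' x) (h (Xp (PiNat.res x (m' x)))) x := by
    intro x hx
    obtain ⟨f, hf, hxf⟩ := (hm' x hx (m' x)).1 le_rfl
    have := hB (PiNat.res x (m' x)) ⟨f, hf, by
      rw [PiNat.res_length]; exact (ag_iff_res.1 hxf).symm⟩
    rw [PiNat.res_length] at this
    obtain ⟨h1, h2, h3, h4, h5, h6⟩ := this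
    exact ⟨h1, h2, h3, h4, h5, ag_iff_res.2 h6⟩
  have hA' : ∀ x, x ∉ F → A (PiNat.res x (m x)) ∈ V ∧ A (PiNat.res x (m x)) ∉ F' ∧
    Yp (PiNat.res x (m x)) ∈ F' ∧ m x ≤ m' (A (PiNat.res x (m x))) ∧
    Ag (m' (A (PiNat.res x (m x)))) (A (PiNat.res x (m x))) (Yp (PiNat.res x (m x))) ∧
    Ag (m x) (g' (Yp (PiNat.res x (m x)))) x := by
    intro x hx
    obtain ⟨f, hf, hxf⟩ := (hm x hx (m x)).1 le_rfl
    have := hA (PiNat.res x (m x)) ⟨f, hf, by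
      rw [PiNat.res_length]; exact (ag_iff_res.1 hxf).symm⟩
    rw [PiNat.res_length] at this
    obtain ⟨h1, h2, h3, h4, h5, h6⟩ := this
    exact ⟨h1, h2, h3, h4, h5, ag_iff_res.2 h6⟩
  have hτ : ∀ i : List T, ∃ (L : ℕ) (τ : (ℕ → T) → Option (List T)),
      (∀ t j, τ t = some j → j ∈ {j | ∃ y ∈ V, y ∉ F' ∧ idx m' N y = j ∧
        idx m N (Bp (PiNat.res y (m' y))) = i}) ∧
      (∀ j ∈ {j | ∃ y ∈ V, y ∉ F' ∧ idx m' N y = j ∧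
        idx m N (Bp (PiNat.res y (m' y))) = i}, ∃ t, τ t = some j) ∧ (∃ t, τ t = none) ∧
      ∀ t t', Ag L t t' → τ t = τ t' := by
    intro i
    refine exists_tau _ fun hT => (List.finite_length_le T i.length).subset ?_
    rintro j ⟨y, hyV, hyF, rfl, rfl⟩
    have := (hB' y hyF).2.2.2.1
    simp only [mem_ofPred_eq, idx_length]
    omega
  have hτ' : ∀ i : List T, ∃ (L : ℕ) (τ : (ℕ → T) → Option (List T)),
      (∀ t j, τ t = some j → j ∈ {j | ∃ y ∈ U, y ∉ F ∧ idx m N y = j ∧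
        idx m' N (A (PiNat.res y (m y))) = i}) ∧
      (∀ j ∈ {j | ∃ y ∈ U, y ∉ F ∧ idx m N y = j ∧
        idx m' N (A (PiNat.res y (m y))) = i}, ∃ t, τ t = some j) ∧ (∃ t, τ t = none) ∧
      ∀ t t', Ag L t t' → τ t = τ t' := by
    intro i
    refine exists_tau _ fun hT => (List.finite_length_le T i.length).subset ?_
    rintro j ⟨y, hyV, hyF, rfl, rfl⟩
    have := (hA' y hyF).2.2.2.1
    simp only [mem_ofPred_eq, idx_length]
    omega
  choose L τ t1 t2 t3 t4 using hτ
  choose L' τ' t1' t2' t3' t4' using hτ'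
  let K : KRD T N :=
    { F := F, U := U, F' := F', V := V, m := m, m' := m', g := h, g' := g', A := A, Yp := Yp,
      Bp := Bp, Xp := Xp, L := L, L' := L', τ := τ, τ' := τ', dU := dU.mono hDN,
      dV := dV.mono hDN, FU := FU, FV := FV, hm := hm, hm' := hm', gF := gF, gF' := gF',
      gg := gg, gg' := gg', hg := hg, hg' := hg', hA := hA', hB := hB',
      τ1 := t1, τ2 := fun y hy hyF => t2 _ _ ⟨y, hy, hyF, rfl, rfl⟩, τ3 := t3, τ4 := t4,
      τ1' := t1', τ2' := fun y hy hyF => t2' _ _ ⟨y, hy, hyF, rfl, rfl⟩, τ3' := t3',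
      τ4' := t4' }
  refine ⟨K.R, ?_, ?_, ?_⟩
  · rintro x y (⟨h1, h2, h3⟩ | ⟨h1, h2, h3, h4, h5⟩)
    · exact ⟨FU h1, FV h2⟩
    · exact ⟨h1, h3⟩
  · have := K.half Y1 Y2 fun x _ => (hY x).symm
    exact ⟨this.usc, this.typ, fun x hx hxZ => this.cov x hx (Or.inl ⟨hxZ, hx⟩)⟩
  · have hR : flip K.R = K.swap.R := by
      funext x y
      exact propext (K.R_swap x y).symm
    rw [hR]
    have := K.swap.half Y2 Y1 fun x (hx : x ∈ F') => by
      change x ∈ Y2 ↔ g' x ∈ Y1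
      rw [← hY (g' x), gg' x hx]
    exact ⟨this.usc, this.typ, fun x _ hx => hx.elim⟩

end KR2
end DH

namespace DH

section KR3
variable {T : Type u}

/-- Boxes of a relation. -/
def IsBox (R : (ℕ → T) → (ℕ → T) → Prop) (U V : Set (ℕ → T)) : Prop :=
  ∃ n, Det n U ∧ Det n V ∧ U.Nonempty ∧ V.Nonempty ∧
    (∀ x' ∈ U, ∀ y', R x' y' ↔ y' ∈ V) ∧ (∀ y' ∈ V, ∀ x', R x' y' ↔ x' ∈ U)

theorem IsBox.flip {R : (ℕ → T) → (ℕ → T) → Prop} {U V : Set (ℕ → T)} (h : IsBox R U V) :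
    IsBox (flip R) V U := by
  obtain ⟨n, h1, h2, h3, h4, h5, h6⟩ := h
  exact ⟨n, h2, h1, h4, h3, h6, h5⟩

theorem Sing.flip {R : (ℕ → T) → (ℕ → T) → Prop} {x y : ℕ → T} (h : Sing R x y) :
    Sing (flip R) y x := ⟨h.1, h.2.2, h.2.1⟩

theorem IsBox.eq {R : (ℕ → T) → (ℕ → T) → Prop} {U V U' V' : Set (ℕ → T)} (h : IsBox R U V)
    (h' : IsBox R U' V') {x : ℕ → T} (hx : x ∈ U) (hx' : x ∈ U') : U = U' ∧ V = V' := by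
  obtain ⟨n, h1, h2, h3, h4, h5, h6⟩ := h
  obtain ⟨n', h1', h2', h3', h4', h5', h6'⟩ := h'
  have hV : V = V' := by
    ext y; rw [← h5 x hx, h5' x hx']
  subst hV
  obtain ⟨y, hy⟩ := h4
  refine ⟨?_, rfl⟩
  ext z; rw [← h6 y hy, h6' y hy]

theorem IsBox.eq' {R : (ℕ → T) → (ℕ → T) → Prop} {U V U' V' : Set (ℕ → T)} (h : IsBox R U V)
    (h' : IsBox R U' V') {x : ℕ → T} (hx : x ∈ V) (hx' : x ∈ V') : U = U' ∧ V = V' :=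
  (h.flip.eq h'.flip hx hx').symm

theorem IsBox.not_sing [Nontrivial T] {R : (ℕ → T) → (ℕ → T) → Prop} {U V : Set (ℕ → T)}
    (h : IsBox R U V) {x y : ℕ → T} (hx : x ∈ U) : ¬ Sing R x y := by
  intro hs
  obtain ⟨n, h1, h2, h3, h4, h5, h6⟩ := h
  have hy : y ∈ V := (h5 x hx y).1 hs.1
  obtain ⟨b, hb, hab⟩ := exists_ne_ag y n
  exact hb (hs.2.1 b ((h5 x hx b).2 (h2 _ _ hab hy)))

theorem IsBox.not_sing' [Nontrivial T] {R : (ℕ → T) → (ℕ → T) → Prop} {U V : Set (ℕ → T)}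
    (h : IsBox R U V) {x y : ℕ → T} (hy : y ∈ V) : ¬ Sing R x y :=
  fun hs => h.flip.not_sing hy hs.flip

/-- Refinement of a relation inside its boxes. -/
def refR (R : (ℕ → T) → (ℕ → T) → Prop)
    (S : Set (ℕ → T) → Set (ℕ → T) → (ℕ → T) → (ℕ → T) → Prop) (x y : ℕ → T) : Prop :=
  Sing R x y ∨ ∃ U V, IsBox R U V ∧ x ∈ U ∧ y ∈ V ∧ S U V x y

theorem refR_flip (R : (ℕ → T) → (ℕ → T) → Prop)
    (S : Set (ℕ → T) → Set (ℕ → T) → (ℕ → T) → (ℕ → T) → Prop) :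
    flip (refR R S) = refR (flip R) (fun V U => flip (S U V)) := by
  funext x y
  apply propext
  constructor
  · rintro (h | ⟨U, V, h1, h2, h3, h4⟩)
    · exact Or.inl h.flip
    · exact Or.inr ⟨V, U, h1.flip, h3, h2, h4⟩
  · rintro (h | ⟨U, V, h1, h2, h3, h4⟩)
    · exact Or.inl h.flip
    · exact Or.inr ⟨V, U, h1.flip, h3, h2, h4⟩

theorem refR_le {R : (ℕ → T) → (ℕ → T) → Prop}
    {S : Set (ℕ → T) → Set (ℕ → T) → (ℕ → T) → (ℕ → T) → Prop} {x y : ℕ → T}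
    (h : refR R S x y) : R x y := by
  rcases h with h | ⟨U, V, ⟨n, h1, h2, h3, h4, h5, h6⟩, hx, hy, -⟩
  · exact h.1
  · exact (h5 x hx y).2 hy

theorem refR_sing {R : (ℕ → T) → (ℕ → T) → Prop}
    {S : Set (ℕ → T) → Set (ℕ → T) → (ℕ → T) → (ℕ → T) → Prop} {x y : ℕ → T}
    (h : Sing R x y) : Sing (refR R S) x y :=
  ⟨Or.inl h, fun y' h' => h.2.1 y' (refR_le h'), fun x' h' => h.2.2 x' (refR_le h')⟩

theorem refR_iff [Nontrivial T] {R : (ℕ → T) → (ℕ → T) → Prop}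
    {S : Set (ℕ → T) → Set (ℕ → T) → (ℕ → T) → (ℕ → T) → Prop} {U V : Set (ℕ → T)}
    (hb : IsBox R U V) (hS : ∀ x y, S U V x y → x ∈ U ∧ y ∈ V) {x y : ℕ → T}
    (hx : x ∈ U ∨ y ∈ V) : refR R S x y ↔ S U V x y := by
  constructor
  · rintro (h | ⟨U', V', h1, h2, h3, h4⟩)
    · rcases hx with hx | hx
      · exact absurd h (hb.not_sing hx)
      · exact absurd h (hb.not_sing' hx)
    · rcases hx with hx | hx
      · obtain ⟨rfl, rfl⟩ := hb.eq h1 hx h2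
        exact h4
      · obtain ⟨rfl, rfl⟩ := hb.eq' h1 hx h3
        exact h4
  · intro h
    exact Or.inr ⟨U, V, hb, (hS x y h).1, (hS x y h).2, h⟩

theorem BoxAt.isBox {R : (ℕ → T) → (ℕ → T) → Prop} {N : ℕ} {x : ℕ → T} (h : BoxAt R N x) :
    ∃ U V, IsBox R U V ∧ x ∈ U := by
  obtain ⟨U, V, n, h1, h2, h3, h4, h5, h6, h7⟩ := h
  exact ⟨U, V, ⟨n, h1, h2, ⟨x, h3⟩, h4, h5, h6⟩, h3⟩

theorem half_step [Nontrivial T] {R : (ℕ → T) → (ℕ → T) → Prop}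
    {S : Set (ℕ → T) → Set (ℕ → T) → (ℕ → T) → (ℕ → T) → Prop} {Y1 Y2 : Set (ℕ → T)} {N N' : ℕ}
    {Z0 Z : Set (ℕ → T)} (hR : Half R Y1 Y2 N univ Z0)
    (hS0 : ∀ U V, IsBox R U V → ∀ x y, S U V x y → x ∈ U ∧ y ∈ V)
    (hS : ∀ U V, IsBox R U V → Half (S U V) Y1 Y2 N' U Z) :
    Half (refR R S) Y1 Y2 N' univ Z := by
  have hsing : ∀ U V, IsBox R U V → ∀ x y, Sing (S U V) x y → Sing (refR R S) x y := by
    intro U V hb x y h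
    obtain ⟨hx, hy⟩ := hS0 U V hb x y h.1
    refine ⟨(refR_iff hb (hS0 U V hb) (Or.inl hx)).2 h.1, fun y' h' => ?_, fun x' h' => ?_⟩
    · exact h.2.1 y' ((refR_iff hb (hS0 U V hb) (Or.inl hx)).1 h')
    · exact h.2.2 x' ((refR_iff hb (hS0 U V hb) (Or.inr hy)).1 h')
  refine ⟨?_, ?_, ?_⟩
  · intro x _ n
    rcases hR.typ x (mem_univ x) with ⟨y, hs, -⟩ | hbx
    · obtain ⟨m, hm⟩ := hR.usc x (mem_univ x) n
      refine ⟨m, fun x' _ hx' y' hy' => ?_⟩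
      obtain ⟨y1, h1, h2⟩ := hm x' (mem_univ _) hx' y' (refR_le hy')
      rw [hs.2.1 y1 h1] at h2
      exact ⟨y, Or.inl hs, h2⟩
    · obtain ⟨U, V, hb, hx⟩ := hbx.isBox
      obtain ⟨m, hm⟩ := (hS U V hb).usc x hx n
      obtain ⟨k, dU, -⟩ := id hb
      refine ⟨max m k, fun x' _ hx' y' hy' => ?_⟩
      have hx'U : x' ∈ U := dU _ _ (hx'.mono (le_max_right _ _)) hx
      obtain ⟨y1, h1, h2⟩ := hm x' hx'U (hx'.mono (le_max_left _ _)) y'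
        ((refR_iff hb (hS0 U V hb) (Or.inl hx'U)).1 hy')
      exact ⟨y1, (refR_iff hb (hS0 U V hb) (Or.inl hx)).2 h1, h2⟩
  · intro x _
    rcases hR.typ x (mem_univ x) with ⟨y, hs, ht⟩ | hbx
    · exact Or.inl ⟨y, refR_sing hs, ht⟩
    · obtain ⟨U, V, hb, hx⟩ := hbx.isBox
      rcases (hS U V hb).typ x hx with ⟨y, hs, ht⟩ | hbx'
      · exact Or.inl ⟨y, hsing U V hb x y hs, ht⟩
      · right
        obtain ⟨U1, V1, n, h1, h2, h3, h4, h5, h6, h7⟩ := hbx'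
        refine ⟨U1, V1, n, h1, h2, h3, h4, ?_, ?_, h7⟩
        · intro x' hx' y'
          obtain ⟨y0, hy0⟩ := h4
          have := (hS0 U V hb _ _ ((h5 x' hx' y0).2 hy0)).1
          rw [refR_iff hb (hS0 U V hb) (Or.inl this)]
          exact h5 x' hx' y'
        · intro y' hy' x'
          have := (hS0 U V hb _ _ ((h6 y' hy' x).2 h3)).2
          rw [refR_iff hb (hS0 U V hb) (Or.inr this)]
          exact h6 y' hy' x'
  · intro x _ hxZ
    rcases hR.typ x (mem_univ x) with ⟨y, hs, ht⟩ | hbx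
    · exact ⟨y, refR_sing hs⟩
    · obtain ⟨U, V, hb, hx⟩ := hbx.isBox
      obtain ⟨y, hy⟩ := (hS U V hb).cov x hx hxZ
      exact ⟨y, hsing U V hb x y hy⟩

theorem BoxAt.mono {R : (ℕ → T) → (ℕ → T) → Prop} {N N' : ℕ} {x : ℕ → T} (h : BoxAt R N x)
    (hN : N' ≤ N) : BoxAt R N' x := by
  obtain ⟨U, V, n, h1, h2, h3, h4, h5, h6, h7, h8⟩ := h
  exact ⟨U, V, n, h1, h2, h3, h4, h5, h6, fun a ha b hb => (h7 a ha b hb).mono hN,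
    fun a ha b hb => (h8 a ha b hb).mono hN⟩

theorem Half.mono {R : (ℕ → T) → (ℕ → T) → Prop} {Y1 Y2 U Z : Set (ℕ → T)} {N N' : ℕ}
    (h : Half R Y1 Y2 N U Z) (hN : N' ≤ N) : Half R Y1 Y2 N' U Z :=
  ⟨h.usc, fun x hx => (h.typ x hx).imp id fun hb => hb.mono hN, h.cov⟩

variable [TopologicalSpace T] [DiscreteTopology T]

/-- The universality hypothesis. -/
def Emb (Y1 Y2 : Set (ℕ → T)) : Prop :=
  ∀ W : Set (ℕ → T), IsOpen W → W.Nonempty → ∃ h : (ℕ → T) → (ℕ → T),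
      IsClosedEmbedding h ∧ range h ⊆ W ∧ ∀ x, h x ∈ Y2 ↔ x ∈ Y1

theorem step1 [Nontrivial T] {R : (ℕ → T) → (ℕ → T) → Prop} {Y1 Y2 : Set (ℕ → T)} {N : ℕ} (N' : ℕ)
    {Z : Set (ℕ → T)} (hR : Half R Y1 Y2 N univ ∅) (hR' : Half (flip R) Y2 Y1 N univ ∅)
    (hZ : IsClosed Z) (hZ' : interior Z = ∅) (hemb : Emb Y1 Y2) :
    ∃ R' : (ℕ → T) → (ℕ → T) → Prop, (∀ x y, R' x y → R x y) ∧
      (∀ x y, Sing R x y → Sing R' x y) ∧ Half R' Y1 Y2 N' univ Z ∧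
      Half (flip R') Y2 Y1 N' univ ∅ := by
  have : ∀ U V : Set (ℕ → T), ∃ S : (ℕ → T) → (ℕ → T) → Prop, IsBox R U V →
      (∀ x y, S x y → x ∈ U ∧ y ∈ V) ∧
      Half S Y1 Y2 N' U Z ∧ Half (flip S) Y2 Y1 N' V ∅ := by
    intro U V
    by_cases hb : IsBox R U V
    · obtain ⟨n, h1, h2, h3, h4, h5, h6⟩ := id hb
      obtain ⟨S, hS1, hS2, hS3⟩ := box_lemma Y1 Y2 (le_max_left n N') h1 h2 h3 h4 hZ hZ' hemb
      exact ⟨S, fun _ => ⟨hS1, hS2.mono (le_max_right _ _), hS3.mono (le_max_right _ _)⟩⟩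
    · exact ⟨fun _ _ => True, fun h => absurd h hb⟩
  choose S hS using this
  refine ⟨refR R S, fun x y => refR_le, fun x y => refR_sing, ?_, ?_⟩
  · exact half_step hR (fun U V hb => (hS U V hb).1) (fun U V hb => (hS U V hb).2.1)
  · rw [refR_flip]
    refine half_step hR' (fun U V hb x y h => ?_) (fun U V hb => (hS V U hb.flip).2.2)
    exact ((hS V U hb.flip).1 y x h).symm

theorem Half.weaken {R : (ℕ → T) → (ℕ → T) → Prop} {Y1 Y2 U Z : Set (ℕ → T)} {N : ℕ}
    (h : Half R Y1 Y2 N U Z) : Half R Y1 Y2 N U ∅ :=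
  ⟨h.usc, h.typ, fun _ _ h => h.elim⟩

theorem step2 [Nontrivial T] {R : (ℕ → T) → (ℕ → T) → Prop} {Y1 Y2 : Set (ℕ → T)} {N : ℕ} (N' : ℕ)
    {Z1 Z2 : Set (ℕ → T)} (hR : Half R Y1 Y2 N univ ∅ ∧ Half (flip R) Y2 Y1 N univ ∅)
    (hZ1 : IsClosed Z1) (hZ1' : interior Z1 = ∅) (hZ2 : IsClosed Z2) (hZ2' : interior Z2 = ∅)
    (hemb : Emb Y1 Y2) (hemb' : Emb Y2 Y1) :
    ∃ R' : (ℕ → T) → (ℕ → T) → Prop, (Half R' Y1 Y2 N' univ ∅ ∧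
      Half (flip R') Y2 Y1 N' univ ∅) ∧ (∀ x y, R' x y → R x y) ∧
      (∀ x y, Sing R x y → Sing R' x y) ∧ (∀ x ∈ Z1, ∃ y, Sing R' x y) ∧
      (∀ y ∈ Z2, ∃ x, Sing R' x y) := by
  obtain ⟨R1, a1, a2, a3, a4⟩ := step1 N' hR.1 hR.2 hZ1 hZ1' hemb
  obtain ⟨R2, b1, b2, b3, b4⟩ := step1 N' (R := flip R1) a4 a3.weaken hZ2 hZ2' hemb'
  refine ⟨flip R2, ⟨b4, b3.weaken⟩, fun x y h => a1 x y (b1 y x h), fun x y h => ?_, ?_, ?_⟩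
  · exact (b2 y x (a2 x y h).flip).flip
  · intro x hx
    obtain ⟨y, hy⟩ := a3.cov x (mem_univ x) hx
    exact ⟨y, (b2 y x hy.flip).flip⟩
  · intro y hy
    obtain ⟨x, hx⟩ := b3.cov y (mem_univ y) hy
    exact ⟨x, hx.flip⟩

theorem fiber {R : ℕ → (ℕ → T) → (ℕ → T) → Prop} {Y1 Y2 : Set (ℕ → T)}
    (hR : ∀ n, Half (R n) Y1 Y2 n univ ∅) (hmono : ∀ n m, n ≤ m → ∀ x y, R m x y → R n x y)
    (hsing : ∀ n m, n ≤ m → ∀ x y, Sing (R n) x y → Sing (R m) x y) :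
    ∃ f : (ℕ → T) → (ℕ → T), Continuous f ∧ ∀ x y, (∀ n, R n x y) ↔ y = f x := by
  have hbox : ∀ x, (∀ n, BoxAt (R n) n x) ∨ ∃ n y, Sing (R n) x y := by
    intro x
    by_cases h : ∀ n, BoxAt (R n) n x
    · exact Or.inl h
    · push Not at h
      obtain ⟨n, hn⟩ := h
      rcases (hR n).typ x (mem_univ x) with ⟨y, hy, -⟩ | h'
      · exact Or.inr ⟨n, y, hy⟩
      · exact absurd h' hn
  have hex : ∀ x, ∃ y, ∀ n, R n x y := by
    intro x
    rcases hbox x with h | ⟨n, y, hy⟩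
    · choose U V k h1 h2 h3 h4 h5 h6 h7 h8 using h
      choose y hy using h4
      have hRy : ∀ n m, n ≤ m → y m ∈ V n := fun n m hnm =>
        (h5 n x (h3 n) _).1 (hmono n m hnm _ _ ((h5 m x (h3 m) _).2 (hy m)))
      have hag : ∀ n, Ag n (y n) (fun i => y (i + 1) i) := fun n i hi =>
        (h8 (i + 1) _ (hRy (i + 1) n hi) _ (hy (i + 1))) i (Nat.lt_succ_self i)
      refine ⟨fun i => y (i + 1) i, fun n => (h5 n x (h3 n) _).2 ?_⟩
      exact h2 n _ _ ((hag (max n (k n))).mono (le_max_right _ _)) (hRy n _ (le_max_left _ _))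
    · refine ⟨y, fun m => ?_⟩
      rcases le_total n m with h | h
      · exact (hsing n m h x y hy).1
      · exact hmono m n h x y hy.1
  choose f hf using hex
  have huniq : ∀ x y, (∀ n, R n x y) → y = f x := by
    intro x y hy
    rcases hbox x with h | ⟨n, y', hy'⟩
    · refine eq_of_ag fun n => ?_
      obtain ⟨U, V, k, h1, h2, h3, h4, h5, h6, h7, h8⟩ := h n
      exact h8 _ ((h5 x h3 y).1 (hy n)) _ ((h5 x h3 _).1 (hf x n))
    · rw [hy'.2.1 y (hy n), hy'.2.1 _ (hf x n)]
  refine ⟨f, ?_, fun x y => ⟨huniq x y, fun h => h ▸ hf x⟩⟩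
  rw [continuous_iff_ag]
  intro x n
  rcases hbox x with h | ⟨k, y', hy'⟩
  · obtain ⟨U, V, k, h1, h2, h3, h4, h5, h6, h7, h8⟩ := h n
    refine mem_nhds_iff_ag.2 ⟨k, fun x' hx' => ?_⟩
    exact h8 _ ((h5 x h3 _).1 (hf x n)) _ ((h5 x' (h1 _ _ hx' h3) _).1 (hf x' n))
  · obtain ⟨m, hm⟩ := (hR k).usc x (mem_univ x) n
    refine mem_nhds_iff_ag.2 ⟨m, fun x' hx' => ?_⟩
    obtain ⟨y, h1, h2⟩ := hm x' (mem_univ _) hx' (f x') (hf x' k)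
    rw [hy'.2.1 y h1, ← hy'.2.1 _ (hf x k)] at h2
    exact h2

/-- The back-and-forth theorem. -/
theorem back_forth [Nontrivial T] {Y1 Y2 : Set (ℕ → T)} {Z1 Z2 : ℕ → Set (ℕ → T)}
    (hZ1 : ∀ n, IsClosed (Z1 n)) (hZ1' : ∀ n, interior (Z1 n) = ∅) (hZ2 : ∀ n, IsClosed (Z2 n))
    (hZ2' : ∀ n, interior (Z2 n) = ∅) (hY1 : Y1 ⊆ ⋃ n, Z1 n) (hY2 : Y2 ⊆ ⋃ n, Z2 n)
    (hemb : Emb Y1 Y2) (hemb' : Emb Y2 Y1) :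
    ∃ f : (ℕ → T) ≃ₜ (ℕ → T), ∀ x, x ∈ Y1 ↔ f x ∈ Y2 := by
  let P : ℕ → ((ℕ → T) → (ℕ → T) → Prop) → Prop := fun n R =>
    Half R Y1 Y2 n univ ∅ ∧ Half (flip R) Y2 Y1 n univ ∅
  have h0' : ∀ (Y1 Y2 : Set (ℕ → T)) (R : (ℕ → T) → (ℕ → T) → Prop), (∀ x y, R x y) →
      Half R Y1 Y2 0 univ ∅ := by
    intro Y1 Y2 R hR
    have hb : ∀ x, BoxAt R 0 x := fun x =>
      ⟨univ, univ, 0, fun _ _ _ _ => mem_univ _, fun _ _ _ _ => mem_univ _, mem_univ _,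
        ⟨x, mem_univ x⟩, fun _ _ _ => by simp [hR], fun _ _ _ => by simp [hR],
        fun _ _ _ _ => Ag.zero _ _, fun _ _ _ _ => Ag.zero _ _⟩
    exact ⟨fun x _ n => ((hb x).usc n).imp fun m hm x' _ => hm x',
      fun x _ => Or.inr (hb x), fun _ _ h => h.elim⟩
  have h0 : P 0 (fun _ _ => True) :=
    ⟨h0' _ _ _ fun _ _ => trivial, h0' _ _ _ fun _ _ => trivial⟩
  have hs : ∀ n (r : {R // P n R}), ∃ r' : {R // P (n + 1) R},
      (∀ x y, r'.1 x y → r.1 x y) ∧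
      (∀ x y, Sing r.1 x y → Sing r'.1 x y) ∧ (∀ x ∈ Z1 n, ∃ y, Sing r'.1 x y) ∧
      (∀ y ∈ Z2 n, ∃ x, Sing r'.1 x y) := by
    rintro n ⟨R, hR⟩
    obtain ⟨R', h1, h2⟩ := step2 (n + 1) hR (hZ1 n) (hZ1' n) (hZ2 n) (hZ2' n) hemb hemb'
    exact ⟨⟨R', h1⟩, h2⟩
  choose nxt hn1 hn2 hn3 hn4 using hs
  let R : (n : ℕ) → {R // P n R} := fun n => Nat.rec ⟨_, h0⟩ nxt n
  have hmono : ∀ n m, n ≤ m → ∀ x y, (R m).1 x y → (R n).1 x y := by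
    intro n m hnm
    induction m, hnm using Nat.le_induction with
    | base => exact fun x y h => h
    | succ m hm ih => exact fun x y h => ih x y (hn1 m (R m) x y h)
  have hsing : ∀ n m, n ≤ m → ∀ x y, Sing (R n).1 x y → Sing (R m).1 x y := by
    intro n m hnm
    induction m, hnm using Nat.le_induction with
    | base => exact fun x y h => h
    | succ m hm ih => exact fun x y h => hn2 m (R m) x y (ih x y h)
  obtain ⟨f, hfc, hf⟩ := fiber (fun n => (R n).2.1) hmono hsing
  obtain ⟨g, hgc, hg⟩ := fiber (R := fun n => flip (R n).1) (fun n => (R n).2.2)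
    (fun n m h x y => hmono n m h y x) (fun n m h x y hxy => (hsing n m h y x hxy.flip).flip)
  have hgf : ∀ x, g (f x) = x := fun x => ((hg (f x) x).1 ((hf x (f x)).2 rfl)).symm
  have hfg : ∀ x, f (g x) = x := fun x => ((hf (g x) x).1 ((hg x (g x)).2 rfl)).symm
  have htyp : ∀ n x y, Sing (R n).1 x y → (x ∈ Y1 ↔ f x ∈ Y2) := by
    intro n x y h
    have hy : f x = y := h.2.1 _ ((hf x (f x)).2 rfl n)
    rcases (R n).2.1.typ x (mem_univ x) with ⟨y', h1, h2⟩ | hb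
    · rw [h2, hy, h.2.1 y' h1.1]
    · obtain ⟨U, V, hb, hx⟩ := hb.isBox
      exact absurd h (hb.not_sing hx)
  refine ⟨⟨⟨f, g, hgf, hfg⟩, hfc, hgc⟩, fun x => ?_⟩
  change x ∈ Y1 ↔ f x ∈ Y2
  constructor
  · intro hx
    obtain ⟨n, hn⟩ := mem_iUnion.1 (hY1 hx)
    obtain ⟨y, hy⟩ := hn3 n (R n) x hn
    exact (htyp (n + 1) x y hy).1 hx
  · intro hx
    obtain ⟨n, hn⟩ := mem_iUnion.1 (hY2 hx)
    obtain ⟨x', hx'⟩ := hn4 n (R n) _ hn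
    have : x = x' := hx'.2.2 x ((hf x (f x)).2 rfl (n + 1))
    subst this
    exact (htyp (n + 1) x _ hx').2 hx

end KR3
end DH

namespace DH

section Rich
variable {D : Type v}

/-- The copy of `Q(k)^ω` in the product. -/
def Qw (o : D) : Set (ℕ → ℕ → D) := {z | ∀ i, ∀ᶠ j in atTop, z i j = o}

/-- Basic boxes. -/
def Bx (r : ℕ → ℕ → D) (d : ℕ) : Set (ℕ → ℕ → D) := {z | ∀ i < d, ∀ j < d, z i j = r i j}

/-- Richness. -/
def Rich (o : D) (M : Set (ℕ → ℕ → D)) : Prop :=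
  ∀ q ∈ Qw o, ∀ d, ∃ q' ∈ Qw o, q' ∈ M ∧ ∀ i < d, q' i = q i

theorem self_mem_Bx (r : ℕ → ℕ → D) (d : ℕ) : r ∈ Bx r d := fun _ _ _ _ => rfl

theorem Bx_mono {r : ℕ → ℕ → D} {d d' : ℕ} (h : d ≤ d') : Bx r d' ⊆ Bx r d :=
  fun _ hz i hi j hj => hz i (hi.trans_le h) j (hj.trans_le h)

theorem Bx_eq {r r' : ℕ → ℕ → D} {d : ℕ} (h : r' ∈ Bx r d) : Bx r' d = Bx r d := by
  ext z
  refine forall₂_congr fun i hi => forall₂_congr fun j hj => ?_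
  rw [h i hi j hj]

variable [TopologicalSpace D] [DiscreteTopology D]

theorem isOpen_Bx (r : ℕ → ℕ → D) (d : ℕ) : IsOpen (Bx r d) := by
  have : Bx r d = ⋂ i ∈ Finset.range d, ⋂ j ∈ Finset.range d, (fun z => z i j) ⁻¹' {r i j} := by
    ext z; simp [Bx]
  rw [this]
  refine isOpen_biInter_finset fun i _ => isOpen_biInter_finset fun j _ => ?_
  exact (isOpen_discrete _).preimage (by fun_prop)

theorem mem_nhds_iff_Bx {s : Set (ℕ → ℕ → D)} {x : ℕ → ℕ → D} :
    s ∈ 𝓝 x ↔ ∃ n, Bx x n ⊆ s := by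
  constructor
  · intro h
    rw [nhds_pi, Filter.mem_pi] at h
    obtain ⟨I, hI, t, ht, hts⟩ := h
    have : ∀ i, ∃ n, ∀ y : ℕ → D, Ag n (x i) y → y ∈ t i := fun i => mem_nhds_iff_ag.1 (ht i)
    choose n hn using this
    obtain ⟨N, hN⟩ := (hI.union (hI.image n)).bddAbove
    refine ⟨N + 1, fun z hz => hts fun i hi => hn i _ fun j hj => ?_⟩
    have h1 : i ≤ N := hN (Or.inl hi)
    have h2 : n i ≤ N := hN (Or.inr (mem_image_of_mem _ hi))
    exact (hz i (by omega) j (by omega)).symm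
  · rintro ⟨n, hn⟩
    exact mem_of_superset ((isOpen_Bx x n).mem_nhds (self_mem_Bx x n)) hn

theorem mem_closure_iff_Bx {s : Set (ℕ → ℕ → D)} {x : ℕ → ℕ → D} :
    x ∈ closure s ↔ ∀ n, ∃ y ∈ s, y ∈ Bx x n := by
  rw [mem_closure_iff_nhds]
  constructor
  · intro h n
    obtain ⟨y, hy, hys⟩ := h _ ((isOpen_Bx x n).mem_nhds (self_mem_Bx x n))
    exact ⟨y, hys, hy⟩
  · intro h t ht
    obtain ⟨n, hn⟩ := mem_nhds_iff_Bx.1 ht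
    obtain ⟨y, hys, hy⟩ := h n
    exact ⟨y, hn hy, hys⟩

theorem baire_pi (S : Type*) [TopologicalSpace S] [DiscreteTopology S] : BaireSpace (ℕ → S) := by
  infer_instance

theorem baire_C : BaireSpace (ℕ → ℕ → D) := by
  infer_instance

theorem rich_lemma (o : D) (hD : ∃ a : D, a ≠ o) {G0 M1 : Set (ℕ → ℕ → D)} (hG0 : IsGδ G0)
    (hM1 : IsGδ M1) (hQ : Qw o ⊆ G0) (hMQ : G0 \ M1 ⊆ Qw o) : Rich o M1 := by
  classical
  by_contra hR
  unfold Rich at hR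
  push Not at hR
  obtain ⟨q, hq, d, hqd⟩ := hR
  obtain ⟨W, hW, hWM⟩ := hM1.eq_iInter_nat
  let S := {c : ℕ → D // ∀ᶠ j in atTop, c j = o}
  let _ : TopologicalSpace S := ⊥
  have : DiscreteTopology S := ⟨rfl⟩
  have : BaireSpace (ℕ → S) := baire_pi S
  have : Nonempty S := ⟨⟨fun _ => o, by simp⟩⟩
  let φ : (ℕ → S) → (ℕ → ℕ → D) := fun z i => if i < d then q i else (z i).1
  have hφc : Continuous φ := by
    refine continuous_pi fun i => ?_
    by_cases hi : i < d
    · simp only [φ, hi, if_true]; exact continuous_const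
    · simp only [φ, hi, if_false]
      exact continuous_of_discreteTopology.comp (continuous_apply i)
  have hφQ : ∀ z, φ z ∈ Qw o := by
    intro z i
    by_cases hi : i < d
    · simp only [φ, hi, if_true]; exact hq i
    · simp only [φ, hi, if_false]; exact (z i).2
  have hcov : ⋃ n, φ ⁻¹' (W n)ᶜ = univ := by
    rw [eq_univ_iff_forall]
    intro z
    have : φ z ∉ M1 := fun h => hqd (φ z) (hφQ z) h |>.elim fun i hi => hi.2 (by
      simp only [φ, hi.1, if_true])
    rw [hWM] at this
    simpa using this
  obtain ⟨n, z0, hz0⟩ := nonempty_interior_of_iUnion_of_closed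
    (fun n => (hW n).isClosed_compl.preimage hφc) hcov
  obtain ⟨d2, hd2⟩ := mem_nhds_iff_ag.1 (mem_interior_iff_mem_nhds.1 hz0)
  let d' := max d d2
  let q' := φ z0
  have h1 : ∀ w ∈ Qw o, (∀ i < d', w i = q' i) → w ∉ W n := by
    intro w hw hwq
    have e : φ (fun i => if i < d then z0 i else ⟨w i, hw i⟩) = w := by
      funext i
      by_cases hi : i < d
      · have := hwq i (hi.trans_le (le_max_left _ _))
        rw [this]; simp only [φ, q', hi, if_true]
      · simp only [φ, hi, if_false]
    rw [← e]
    refine hd2 _ fun i hi => ?_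
    by_cases hi' : i < d
    · simp [hi']
    · simp only [hi', if_false]
      apply Subtype.ext
      have := hwq i (hi.trans_le (le_max_right _ _))
      change (z0 i).1 = w i
      rw [this]
      simp only [φ, q', hi', if_false]
  have h2 : ∀ w, (∀ i < d', w i = q' i) → w ∉ W n := by
    intro w hw
    have hcl : w ∈ closure ((W n)ᶜ) := by
      rw [mem_closure_iff_Bx]
      intro m
      refine ⟨fun i j => if i < d' ∨ j < m then w i j else o, ?_, ?_⟩
      · refine h1 _ (fun i => ?_) fun i hi => ?_
        · by_cases hi : i < d'
          · simp only [hi, true_or, if_true]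
            rw [hw i hi]; exact hφQ z0 i
          · filter_upwards [eventually_ge_atTop m] with j hj
            simp [hi, hj]
        · simp only [hi, true_or, if_true]
          exact hw i hi
      · intro i hi j hj
        simp [hj]
    rwa [(hW n).isClosed_compl.closure_eq] at hcl
  let ψ : (ℕ → ℕ → D) → (ℕ → ℕ → D) := fun z i => if i < d' then q' i else z (i - d')
  have hψc : Continuous ψ := by
    refine continuous_pi fun i => ?_
    by_cases hi : i < d'
    · simp only [ψ, hi, if_true]; exact continuous_const
    · simp only [ψ, hi, if_false]; exact continuous_apply _
  have : BaireSpace (ℕ → ℕ → D) := baire_C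
  have hQd : Dense (Qw o) := by
    intro z
    rw [mem_closure_iff_Bx]
    intro m
    refine ⟨fun i j => if j < m then z i j else o, fun i => ?_, fun i hi j hj => ?_⟩
    · filter_upwards [eventually_ge_atTop m] with j hj
      simp [hj]
    · simp [hj]
  have d1 : Dense (ψ ⁻¹' G0) := by
    refine hQd.mono fun z hz => hQ fun i => ?_
    by_cases hi : i < d'
    · simp only [ψ, hi, if_true]; exact hφQ z0 i
    · simp only [ψ, hi, if_false]; exact hz _
  have g1 : IsGδ (ψ ⁻¹' G0) := hG0.preimage hψc
  have o2 : ∀ n : ℕ, IsOpen {z : ℕ → ℕ → D | ∃ j ≥ n, z 0 j ≠ o} := by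
    intro n
    have : {z : ℕ → ℕ → D | ∃ j ≥ n, z 0 j ≠ o} = ⋃ j, ⋃ (_ : j ≥ n), (fun z => z 0 j) ⁻¹' {o}ᶜ := by
      ext z; simp
    rw [this]
    exact isOpen_iUnion fun j => isOpen_iUnion fun _ => (isOpen_discrete _).preimage (by fun_prop)
  obtain ⟨a, ha⟩ := hD
  have d2 : ∀ n : ℕ, Dense {z : ℕ → ℕ → D | ∃ j ≥ n, z 0 j ≠ o} := by
    intro n z
    rw [mem_closure_iff_Bx]
    intro m
    refine ⟨fun i j => if j < m then z i j else a, ⟨max n m, le_max_left _ _, ?_⟩,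
      fun i hi j hj => ?_⟩
    · simpa using ha
    · simp [hj]
  have d3 := Dense.inter_of_Gδ g1 (IsGδ.iInter_of_isOpen o2) d1 (dense_iInter_of_isOpen o2 d2)
  have : Nonempty (ℕ → ℕ → D) := ⟨q⟩
  obtain ⟨z, hz1, hz2⟩ := d3.nonempty
  have hz3 : ψ z ∉ M1 := by
    rw [hWM]
    intro h
    refine h2 (ψ z) (fun i hi => ?_) (mem_iInter.1 h n)
    simp only [ψ, hi, if_true]
  have hz4 : ψ z ∈ Qw o := hMQ ⟨hz1, hz3⟩
  have := hz4 d'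
  simp only [ψ, lt_irrefl, if_false, Nat.sub_self] at this
  obtain ⟨m, hm⟩ := eventually_atTop.1 this
  obtain ⟨j, hj, hj'⟩ := mem_iInter.1 hz2 m
  exact hj' (hm j hj)

end Rich
end DH

namespace DH

section Flags

theorem mono_bdd_iff {f : ℕ → ℕ} (hf : Monotone f) :
    (∀ᶠ n in atTop, ¬ f (n - 1) < f n) ↔ ∃ b, ∀ n, f n ≤ b := by
  constructor
  · intro h
    obtain ⟨N, hN⟩ := eventually_atTop.1 h
    refine ⟨f N, fun n => ?_⟩
    rcases le_total n N with h | h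
    · exact hf h
    · induction n, h using Nat.le_induction with
      | base => exact le_rfl
      | succ m hm ih =>
        have := hN (m + 1) (by omega)
        simp only [Nat.add_sub_cancel] at this
        omega
  · rintro ⟨b, hb⟩
    by_contra hc
    have hc' : ∀ N, ∃ n ≥ N, f (n - 1) < f n := by
      intro N
      by_contra h'
      push Not at h'
      exact hc (eventually_atTop.2 ⟨N, fun n hn => not_lt.2 (h' n hn)⟩)
    have : ∀ k, ∃ n, k ≤ f n := by
      intro k
      induction k with
      | zero => exact ⟨0, Nat.zero_le _⟩
      | succ k ih =>
        obtain ⟨n, hn⟩ := ih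
        obtain ⟨m, hm, hm'⟩ := hc' (n + 1)
        have : f n ≤ f (m - 1) := hf (by omega)
        exact ⟨m, by omega⟩
    obtain ⟨n, hn⟩ := this (b + 1)
    have := hb n
    omega

variable {T : Type u} [TopologicalSpace T] [DiscreteTopology T]

theorem flag_one {G : Set (ℕ → T)} (hG : IsGδ G) :
    ∃ c : List T → Prop, ∀ x, x ∉ G ↔ ∀ᶠ n in atTop, ¬ c (PiNat.res x n) := by
  classical
  obtain ⟨W, hW, rfl⟩ := hG.eq_iInter_nat
  let A : ℕ → List T → Prop := fun m s => ∀ x, PiNat.res x s.length = s → ∀ l < m, x ∈ W l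
  let lam : List T → ℕ := fun s => Nat.findGreatest (fun m => A m s) s.length
  have A0 : ∀ s, A 0 s := fun s x _ l hl => absurd hl (Nat.not_lt_zero l)
  have hspec : ∀ s, A (lam s) s := fun s =>
    Nat.findGreatest_spec (P := fun m => A m s) (Nat.zero_le _) (A0 s)
  have hmono : ∀ x, Monotone fun n => lam (PiNat.res x n) := by
    intro x
    refine monotone_nat_of_le_succ fun n => ?_
    refine Nat.le_findGreatest ((Nat.findGreatest_le _).trans ?_) ?_
    · rw [PiNat.res_length, PiNat.res_length]; omega
    · intro y hy l hl
      refine hspec _ y ?_ l hl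
      rw [PiNat.res_length] at hy ⊢
      exact ag_iff_res.1 ((ag_iff_res.2 hy).mono (by omega))
  refine ⟨fun s => lam s.tail < lam s, fun x => ?_⟩
  have ht : ∀ n, (PiNat.res x n).tail = PiNat.res x (n - 1) := by
    intro n; cases n <;> simp [PiNat.res]
  simp only [ht]
  rw [mono_bdd_iff (hmono x)]
  constructor
  · intro hx
    by_contra hb
    push Not at hb
    apply hx
    rw [mem_iInter]
    intro l
    obtain ⟨n, hn⟩ := hb l
    exact hspec _ x (by rw [PiNat.res_length]) l hn
  · rintro ⟨b, hb⟩ hx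
    have : (⋂ l ∈ Finset.range (b + 1), W l) ∈ 𝓝 x := by
      refine (isOpen_biInter_finset fun l _ => hW l).mem_nhds ?_
      simp only [mem_iInter]
      exact fun l _ => mem_iInter.1 hx l
    obtain ⟨n, hn⟩ := mem_nhds_iff_ag.1 this
    have h1 : b + 1 ≤ lam (PiNat.res x (max n (b + 1))) := by
      refine Nat.le_findGreatest (by rw [PiNat.res_length]; exact le_max_right _ _) ?_
      intro y hy l hl
      rw [PiNat.res_length] at hy
      have := hn y ((ag_iff_res.2 hy.symm).mono (le_max_left _ _))
      simp only [mem_iInter] at this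
      exact this l (Finset.mem_range.2 hl)
    have := hb (max n (b + 1))
    omega

theorem flags {P : Set (ℕ → T)} {G : ℕ → Set (ℕ → T)} (hG : ∀ i, IsGδ (G i)) (hP : Pᶜ = ⋃ i, G i) :
    ∃ c : ℕ → List T → Prop, ∀ x, x ∈ P ↔ ∀ i, ∀ᶠ n in atTop, ¬ c i (PiNat.res x n) := by
  choose c hc using fun i => flag_one (hG i)
  refine ⟨c, fun x => ?_⟩
  simp only [← hc]
  rw [← not_not (a := x ∈ P), ← mem_compl_iff, hP]
  simp

end Flags
end DH

namespace DH

section Branch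
variable {D T : Type u} [TopologicalSpace D] [DiscreteTopology D]
  [TopologicalSpace T] [DiscreteTopology T]

theorem GH.ag_box (E : GH (ℕ → ℕ → D) (ℕ → T)) {z : ℕ → ℕ → D} (hz : z ∈ E.e.source) (n : ℕ) :
    ∃ m, ∀ w ∈ Bx z m, w ∈ E.e.source → Ag n (E.e z) (E.e w) := by
  have := continuousWithinAt_iff_ag.1 (E.cs z hz) n
  rw [eventually_nhdsWithin_iff] at this
  obtain ⟨m, hm⟩ := mem_nhds_iff_Bx.1 this
  exact ⟨m, fun w hw hws => hm hw hws⟩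

theorem cluster (o : D) (ι : T → D) (hι : Function.Injective ι) (E : GH (ℕ → ℕ → D) (ℕ → T))
    (hM : Rich o E.e.source) {q : ℕ → ℕ → D} (hq : q ∈ Qw o) (d : ℕ) :
    ∃ (r : T → ℕ → ℕ → D) (f : T → ℕ), (∀ a, r a ∈ Qw o) ∧ (∀ a, r a ∈ E.e.source) ∧
      (∀ a, ∀ i < d, r a i = q i) ∧ ∀ a b, Ag (f a) (E.e (r a)) (E.e (r b)) → a = b := by
  have h1 : ∀ a : T, ∃ r ∈ Qw o, r ∈ E.e.source ∧ (∀ i < d, r i = q i) ∧ r d 0 = ι a := by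
    intro a
    have hq' : Function.update q d (Function.update (fun _ => o) 0 (ι a)) ∈ Qw o := by
      intro i
      by_cases hi : i = d
      · subst hi
        rw [Function.update_self]
        filter_upwards [eventually_gt_atTop 0] with j hj
        rw [Function.update_of_ne (by omega)]
      · rw [Function.update_of_ne hi]
        exact hq i
    obtain ⟨r, h1, h2, h3⟩ := hM _ hq' (d + 1)
    refine ⟨r, h1, h2, fun i hi => ?_, ?_⟩
    · rw [h3 i (by omega), Function.update_of_ne (by omega)]
    · rw [h3 d (by omega), Function.update_self, Function.update_self]
  choose r hr1 hr2 hr3 hr4 using h1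
  have h2 : ∀ a, ∃ n, ∀ b, Ag n (E.e (r a)) (E.e (r b)) → a = b := by
    intro a
    have hc := E.ct (E.e (r a)) (E.e.map_source (hr2 a))
    have ho : {z : ℕ → ℕ → D | z d 0 = ι a} ∈ 𝓝 (E.e.symm (E.e (r a))) := by
      rw [E.e.left_inv (hr2 a)]
      refine IsOpen.mem_nhds ?_ (hr4 a)
      exact (isOpen_discrete {ι a}).preimage (f := fun z : ℕ → ℕ → D => z d 0) (by fun_prop)
    have := hc ho
    rw [mem_map, ← eventually_mem_set, eventually_nhdsWithin_iff] at this
    obtain ⟨n, hn⟩ := mem_nhds_iff_ag.1 this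
    refine ⟨n, fun b hb => ?_⟩
    have h3 : E.e.symm (E.e (r b)) d 0 = ι a := hn _ hb (E.e.map_source (hr2 b))
    rw [E.e.left_inv (hr2 b), hr4 b] at h3
    exact (hι h3).symm
  choose f hf using h2
  exact ⟨r, f, hr1, hr2, hr3, hf⟩

theorem card_aux {f : T → ℕ} {κ : Cardinal.{u}} (hκ : κ < Cardinal.mk T) (hT : Uncountable T)
    (L0 : ℕ) : ∃ L ≥ L0, κ ≤ Cardinal.mk {a | f a ≤ L} := by
  by_contra hc
  push Not at hc
  have h1 : Cardinal.mk T ≤ Cardinal.sum (fun L : ℕ => Cardinal.mk {a | f a ≤ max L L0}) := by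
    rw [← Cardinal.mk_sigma]
    refine Cardinal.mk_le_of_injective (f := fun a => ⟨f a, a, mem_ofPred_eq ▸ le_max_left (f a) L0⟩) ?_
    intro a b hab
    have h1 : f a = f b := congrArg Sigma.fst hab
    have h2 := congrArg (fun s : (Σ L : ℕ, {a | f a ≤ max L L0}) => (s.2 : T)) hab
    exact h2
  have h2 : Cardinal.sum (fun L : ℕ => Cardinal.mk {a | f a ≤ max L L0}) ≤
      Cardinal.sum (fun _ : ℕ => κ) :=
    Cardinal.sum_le_sum _ _ fun L => (hc _ (le_max_right _ _)).le
  have h3 : Cardinal.sum (fun _ : ℕ => κ) = Cardinal.aleph0 * κ := by simp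
  have h4 : Cardinal.aleph0 * κ ≤ max Cardinal.aleph0 κ := by
    rcases le_total Cardinal.aleph0 κ with h | h
    · exact (Cardinal.mul_le_max_of_aleph0_le_left le_rfl)
    · exact (Cardinal.mul_le_max_of_aleph0_le_left le_rfl)
  have h5 : max Cardinal.aleph0 κ < Cardinal.mk T := max_lt (Cardinal.aleph0_lt_mk_iff.2 hT) hκ
  exact absurd (h1.trans (h2.trans (h3.le.trans h4))) (not_le.2 h5)

theorem branch_pts (o : D) (ι : T → D) (hι : Function.Injective ι)
    (hT : Finite T ∨ Uncountable T) (E : GH (ℕ → ℕ → D) (ℕ → T))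
    (hM : Rich o E.e.source) {q : ℕ → ℕ → D} (hq : q ∈ Qw o) (d : ℕ) :
    ∃ (r : T → ℕ → ℕ → D) (l : T → ℕ), (∀ a, r a ∈ Qw o) ∧ (∀ a, r a ∈ E.e.source) ∧
      (∀ a, ∀ i < d, r a i = q i) ∧ ∀ y, ∃ n, ∀ a b w w', Ag (l a) (E.e (r a)) w →
        Ag (l b) (E.e (r b)) w' → Ag n y w → Ag n y w' → a = b := by
  obtain ⟨r, f, hr1, hr2, hr3, hf⟩ := cluster o ι hι E hM hq d
  by_cases hL : ∃ L, Cardinal.mk T ≤ Cardinal.mk {a | f a ≤ L}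
  · obtain ⟨L, ⟨j⟩⟩ := hL
    refine ⟨fun a => r (j a), fun _ => L, fun a => hr1 _, fun a => hr2 _, fun a => hr3 _,
      fun y => ⟨L, fun a b w w' h1 h2 h3 h4 => ?_⟩⟩
    have h5 := (h1.trans h3.symm).trans (h4.trans h2.symm)
    exact j.injective (Subtype.ext (hf _ _ (h5.mono (j a).2)))
  push Not at hL
  have hTu : Uncountable T := by
    rcases hT with hT | hT
    · exfalso
      obtain ⟨L, hL'⟩ := (Set.finite_range f).bddAbove
      refine absurd (hL L) (not_lt.2 ?_)
      rw [← Cardinal.mk_univ]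
      exact Cardinal.mk_le_mk_of_subset fun a _ => hL' (mem_range_self a)
    · exact hT
  have hL0 : ∃ L0, {a | f a ≤ L0}.Infinite := by
    by_contra hc
    push Not at hc
    have : (univ : Set T).Countable := by
      have e : (univ : Set T) = ⋃ L, {a | f a ≤ L} := by
        ext a; simp only [mem_univ, mem_iUnion, true_iff]; exact ⟨f a, le_refl (f a)⟩
      rw [e]
      exact countable_iUnion fun L => (hc L).countable
    exact not_countable (countable_univ_iff.1 this)
  obtain ⟨L0, hL0⟩ := hL0
  have j0 := hL0.natEmbedding
  have hpd : ∀ i : ℕ, ∃ m ≥ d, ∀ w ∈ Bx (r (j0 i)) m, w ∈ E.e.source →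
      Ag L0 (E.e (r (j0 i))) (E.e w) := by
    intro i
    obtain ⟨m, hm⟩ := E.ag_box (hr2 (j0 i)) L0
    exact ⟨max m d, le_max_right _ _, fun w hw => hm w (Bx_mono (le_max_left _ _) hw)⟩
  choose m hm1 hm2 using hpd
  have hcl := fun i : ℕ => cluster o ι hι E hM (hr1 (j0 i)) (m i)
  choose R F hR1 hR2 hR3 hF using hcl
  have hLi := fun i : ℕ => card_aux (f := F i) (hL i) hTu L0
  choose L hLL0 hLc using hLi
  have hj : ∀ i : ℕ, Nonempty ({a | f a ≤ i} ↪ {a | F i a ≤ L i}) := fun i => hLc i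
  let j : ∀ i : ℕ, {a | f a ≤ i} ↪ {a | F i a ≤ L i} := fun i => (hj i).some
  refine ⟨fun a => R (f a) (j (f a) ⟨a, le_refl (f a)⟩), fun a => L (f a), fun a => hR1 _ _,
    fun a => hR2 _ _, fun a i hi => ?_, fun y => ?_⟩
  · change R (f a) (j (f a) ⟨a, le_refl (f a)⟩) i = q i
    rw [hR3 _ _ i (lt_of_lt_of_le hi (hm1 _)), hr3 _ i hi]
  have key : ∀ i a w n, L0 ≤ n → Ag L0 y (E.e (r (j0 i))) →
      Ag (L (f a)) (E.e (R (f a) (j (f a) ⟨a, le_refl (f a)⟩))) w → Ag n y w → f a = i := by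
    intro i a w n hn hi h1 h2
    have h3 : Ag L0 (E.e (r (j0 (f a)))) (E.e (R (f a) (j (f a) ⟨a, le_refl (f a)⟩))) := by
      refine hm2 _ _ (fun i' hi' j' hj' => ?_) (hR2 _ _)
      rw [hR3 _ _ i' hi']
    have h4 := ((h3.trans (h1.mono (hLL0 _))).trans (h2.mono hn).symm).trans hi
    exact j0.injective (Subtype.ext (hf _ _ (h4.mono (j0 (f a)).2)))
  by_cases hy : ∃ i, Ag L0 y (E.e (r (j0 i)))
  · obtain ⟨i, hi⟩ := hy
    refine ⟨L i, fun a b w w' h1 h2 h3 h4 => ?_⟩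
    have ha := key i a w _ (hLL0 i) hi h1 h3
    have hb := key i b w' _ (hLL0 i) hi h2 h4
    subst ha
    have h5 : ∀ (i' : ℕ) (b : T) (hb : f b = i'),
        (⟨i', j i' ⟨b, hb.le⟩⟩ : Σ i, {a | F i a ≤ L i}) = ⟨f b, j (f b) ⟨b, le_refl (f b)⟩⟩ := by
      rintro _ b rfl; rfl
    have h6 : R (f b) (j (f b) ⟨b, le_refl (f b)⟩) = R (f a) (j (f a) ⟨b, hb.le⟩) := by
      have := congrArg (fun s : (Σ i, {a | F i a ≤ L i}) => R s.1 s.2) (h5 (f a) b hb)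
      exact this.symm
    have h10 : L (f b) = L (f a) := by rw [hb]
    have h2' : Ag (L (f a)) (E.e (R (f a) (j (f a) ⟨b, hb.le⟩))) w' := by
      rw [← h6, ← h10]; exact h2
    have h7 := (h1.trans h3.symm).trans (h4.trans h2'.symm)
    have h8 := hF _ _ _ (h7.mono (j (f a) ⟨a, le_refl (f a)⟩).2)
    have h9 := (j (f a)).injective (Subtype.ext h8)
    exact congrArg Subtype.val h9
  · push Not at hy
    refine ⟨L0, fun a b w w' h1 h2 h3 h4 => ?_⟩
    exfalso
    have h3' : Ag L0 (E.e (r (j0 (f a)))) (E.e (R (f a) (j (f a) ⟨a, le_refl (f a)⟩))) := by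
      refine hm2 _ _ (fun i' hi' j' hj' => ?_) (hR2 _ _)
      rw [hR3 _ _ i' hi']
    exact hy (f a) ((h3'.trans (h1.mono (hLL0 _))).trans h3.symm).symm

theorem branch (o : D) (ι : T → D) (hι : Function.Injective ι)
    (hT : Finite T ∨ Uncountable T) (E : GH (ℕ → ℕ → D) (ℕ → T))
    (hM : Rich o E.e.source) {q : ℕ → ℕ → D} (hq : q ∈ Qw o) (d : ℕ)
    {W : Set (ℕ → ℕ → D)} (hW : IsOpen W) (hMW : E.e.source ⊆ W) :
    ∃ (r : T → ℕ → ℕ → D) (δ : T → ℕ), (∀ a, r a ∈ Qw o) ∧ (∀ a, r a ∈ E.e.source) ∧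
      (∀ a, ∀ i < d, r a i = q i) ∧ (∀ a, d < δ a) ∧ (∀ a, Bx (r a) (δ a) ⊆ W) ∧
      ∀ y, ∃ n, ∀ a b z z', z ∈ Bx (r a) (δ a) → z ∈ E.e.source → z' ∈ Bx (r b) (δ b) →
        z' ∈ E.e.source → Ag n y (E.e z) → Ag n y (E.e z') → a = b := by
  obtain ⟨r, l, h1, h2, h3, h4⟩ := branch_pts o ι hι hT E hM hq d
  have hδ : ∀ a, ∃ δ, d < δ ∧ Bx (r a) δ ⊆ W ∧ ∀ w ∈ Bx (r a) δ, w ∈ E.e.source →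
      Ag (l a) (E.e (r a)) (E.e w) := by
    intro a
    obtain ⟨m, hm⟩ := E.ag_box (h2 a) (l a)
    obtain ⟨m', hm'⟩ := mem_nhds_iff_Bx.1 (hW.mem_nhds (hMW (h2 a)))
    refine ⟨max (max m m') (d + 1), by omega, (Bx_mono (by simp)).trans hm', fun w hw => ?_⟩
    exact hm w (Bx_mono (by simp) hw)
  choose δ d1 d2 d3 using hδ
  refine ⟨r, δ, h1, h2, h3, d1, d2, fun y => ?_⟩
  obtain ⟨n, hn⟩ := h4 y
  exact ⟨n, fun a b z z' hz hzs hz' hzs' => hn a b _ _ (d3 a z hz hzs) (d3 b z' hz' hzs')⟩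

end Branch
end DH

namespace DH

section Univ
variable {D T : Type u} [TopologicalSpace D] [DiscreteTopology D]
  [TopologicalSpace T] [DiscreteTopology T]

theorem closedEmb_of_det {h : (ℕ → T) → ℕ → T} (hc : Continuous h)
    (hd : ∀ y m, ∃ n, ∀ x x', Ag n y (h x) → Ag n y (h x') → Ag m x x') :
    IsClosedEmbedding h := by
  refine IsClosedEmbedding.of_continuous_injective_isClosedMap hc ?_ ?_
  · intro x x' hx
    refine eq_of_ag fun m => ?_
    obtain ⟨n, hn⟩ := hd (h x) m
    exact hn x x' (Ag.refl _ _) (hx ▸ Ag.refl _ _)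
  · intro F hF
    refine isClosed_of_closure_subset fun y hy => ?_
    have hy' : ∀ n, ∃ x ∈ F, Ag n y (h x) := by
      intro n
      obtain ⟨_, ⟨x, hx, rfl⟩, hn⟩ := mem_closure_iff_ag.1 hy n
      exact ⟨x, hx, hn⟩
    choose X hXF hX using hy'
    choose N hN using hd y
    have key : ∀ m, ∃ K, ∀ k ≥ K, Ag m (fun i => X (N (i + 1)) i) (X k) := by
      intro m
      refine ⟨(Finset.range (m + 1)).sup N, fun k hk i hi => ?_⟩
      have h1 : N (i + 1) ≤ k :=
        (Finset.le_sup (f := N) (Finset.mem_range.2 (by omega))).trans hk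
      exact hN (i + 1) _ _ (hX _) ((hX k).mono h1) i (by omega)
    refine ⟨fun i => X (N (i + 1)) i, ?_, ?_⟩
    · rw [← hF.closure_eq, mem_closure_iff_ag]
      intro n
      obtain ⟨K, hK⟩ := key n
      exact ⟨X K, hXF K, hK K le_rfl⟩
    · refine eq_of_ag fun n => ?_
      have h1 := (isOpen_ag n (h fun i => X (N (i + 1)) i)).preimage hc
      obtain ⟨m, hm⟩ := mem_nhds_iff_ag.1 (h1.mem_nhds (Ag.refl n _))
      obtain ⟨K, hK⟩ := key m
      have h2 : Ag n _ _ := hm _ (hK (max K n) (le_max_left _ _))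
      exact h2.trans ((hX (max K n)).mono (le_max_right _ _)).symm

/-- the tree of boxes -/
def tree {S : Type*} (p0 : S) (nx : List T → S → T → S) : List T → S
  | [] => p0
  | a :: s => nx s (tree p0 nx s) a

theorem universal (o : D) (ι : T → D) (hι : Function.Injective ι) (hD : ∃ a : D, a ≠ o)
    (hT : Finite T ∨ Uncountable T) (E : GH (ℕ → ℕ → D) (ℕ → T))
    (hM : Rich o E.e.source) {q0 : ℕ → ℕ → D} (hq0 : q0 ∈ Qw o) (d0 : ℕ) {U : Set (ℕ → T)}
    (hU : ∀ z ∈ Bx q0 d0, z ∈ E.e.source → E.e z ∈ U) {P : Set (ℕ → T)}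
    {c : ℕ → List T → Prop} (hc : ∀ x, x ∈ P ↔ ∀ i, ∀ᶠ n in atTop, ¬ c i (PiNat.res x n)) :
    ∃ z : (ℕ → T) → ℕ → ℕ → D, (∀ x, z x ∈ E.e.source) ∧ (∀ x, z x ∈ Qw o ↔ x ∈ P) ∧
      (∀ x, E.e (z x) ∈ U) ∧ IsClosedEmbedding fun x => E.e (z x) := by
  classical
  obtain ⟨a0, ha0⟩ := hD
  obtain ⟨W, hW, hWs⟩ := E.gs.eq_iInter_nat
  have step : ∀ (s : List T) (p : {w : ℕ → ℕ → D // w ∈ Qw o} × ℕ),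
      ∃ nx : T → {w : ℕ → ℕ → D // w ∈ Qw o} × ℕ,
      (∀ a, ∀ i < p.2, (nx a).1.1 i =
        if c i s then Function.update (p.1.1 i) p.2 a0 else p.1.1 i) ∧
      (∀ a, p.2 < (nx a).2) ∧ (∀ a, Bx (nx a).1.1 (nx a).2 ⊆ W s.length) ∧
      ∀ y, ∃ n, ∀ a b z z', z ∈ Bx (nx a).1.1 (nx a).2 → z ∈ E.e.source →
        z' ∈ Bx (nx b).1.1 (nx b).2 →
        z' ∈ E.e.source → Ag n y (E.e z) → Ag n y (E.e z') → a = b := by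
    rintro s ⟨⟨q, hq⟩, d⟩
    have hq1 : (fun i => if c i s then Function.update (q i) d a0 else q i) ∈ Qw o := by
      intro i
      filter_upwards [hq i, eventually_gt_atTop d] with j hj hjd
      split_ifs
      · rw [Function.update_of_ne (by omega), hj]
      · exact hj
    have hMW : E.e.source ⊆ W s.length := by
      rw [hWs]; exact iInter_subset _ _
    obtain ⟨r, δ, h1, h2, h3, h4, h5, h6⟩ := branch o ι hι hT E hM hq1 d (hW s.length) hMW
    exact ⟨fun a => ⟨⟨r a, h1 a⟩, δ a⟩, h3, h4, h5, h6⟩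
  choose nx n1 n2 n3 n4 using step
  let st := tree ((⟨q0, hq0⟩ : {w : ℕ → ℕ → D // w ∈ Qw o}), d0) nx
  let q : (ℕ → T) → ℕ → ℕ → ℕ → D := fun x n => (st (PiNat.res x n)).1.1
  let d : (ℕ → T) → ℕ → ℕ := fun x n => (st (PiNat.res x n)).2
  have hq : ∀ x n, q x n ∈ Qw o := fun x n => (st (PiNat.res x n)).1.2
  have m1 : ∀ x n, ∀ i < d x n, q x (n + 1) i =
      if c i (PiNat.res x n) then Function.update (q x n i) (d x n) a0 else q x n i :=
    fun x n => n1 (PiNat.res x n) (st (PiNat.res x n)) (x n)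
  have m2 : ∀ x n, d x n < d x (n + 1) :=
    fun x n => n2 (PiNat.res x n) (st (PiNat.res x n)) (x n)
  have m3 : ∀ x n, Bx (q x (n + 1)) (d x (n + 1)) ⊆ W n := fun x n => by
    have := n3 (PiNat.res x n) (st (PiNat.res x n)) (x n)
    rwa [PiNat.res_length] at this
  have dmono : ∀ x, StrictMono (d x) := fun x => strictMono_nat_of_lt_succ (m2 x)
  have dge : ∀ x n, n ≤ d x n := fun x n => (dmono x).le_apply
  have nest : ∀ x n m, n ≤ m → q x m ∈ Bx (q x n) (d x n) := by
    intro x n m hnm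
    induction m, hnm using Nat.le_induction with
    | base => exact self_mem_Bx _ _
    | succ m hm ih =>
      intro i hi j hj
      have hdm : d x n ≤ d x m := (dmono x).monotone hm
      rw [m1 x m i (by omega)]
      split_ifs
      · rw [Function.update_of_ne (by omega)]
        exact ih i hi j hj
      · exact ih i hi j hj
  let z : (ℕ → T) → ℕ → ℕ → D := fun x i j => q x (max i j + 1) i j
  have hz : ∀ x n, z x ∈ Bx (q x n) (d x n) := by
    intro x n i hi j hj
    change q x (max i j + 1) i j = _
    have h1 := dge x (max i j + 1)
    rcases le_total n (max i j + 1) with h | h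
    · exact nest x _ _ h i hi j hj
    · exact (nest x _ _ h i (by omega) j (by omega)).symm
  have hzs : ∀ x, z x ∈ E.e.source := by
    intro x
    rw [hWs]
    exact mem_iInter.2 fun n => m3 x n (hz x (n + 1))
  refine ⟨z, hzs, fun x => ?_, fun x => hU _ (hz x 0) (hzs x), closedEmb_of_det ?_ ?_⟩
  · rw [hc]
    refine forall_congr' fun i => ?_
    constructor
    · intro hi
      obtain ⟨J, hJ⟩ := eventually_atTop.1 hi
      filter_upwards [eventually_ge_atTop J, eventually_gt_atTop i] with n hn hni hcn
      have h1 := dge x n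
      have h2 := hz x (n + 1) i (by have := m2 x n; omega) (d x n) (m2 x n)
      rw [m1 x n i (by omega), if_pos hcn, Function.update_self] at h2
      exact ha0 (h2.symm.trans (hJ _ (by omega)))
    · intro hi
      obtain ⟨N, hN⟩ := eventually_atTop.1 hi
      have h1 : ∀ n ≥ max N (i + 1), q x n i = q x (max N (i + 1)) i := by
        intro n hn
        induction n, hn using Nat.le_induction with
        | base => rfl
        | succ n hn ih =>
          have h1 := dge x n
          rw [m1 x n i (by omega), if_neg (hN n (by omega)), ih]
      filter_upwards [hq x (max N (i + 1)) i] with j hj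
      rw [← hj, ← h1 (max (max N (i + 1)) (j + 1)) (le_max_left _ _)]
      have := dge x (max (max N (i + 1)) (j + 1))
      exact hz x _ i (by omega) j (by omega)
  · have hzc : Continuous z := by
      refine continuous_iff_continuousAt.2 fun x s hs => ?_
      obtain ⟨n, hn⟩ := mem_nhds_iff_Bx.1 hs
      refine mem_nhds_iff_ag.2 ⟨n, fun y hy => hn ?_⟩
      have h1 := hz y n
      have h2 := hz x n
      have h3 : Bx (q x n) (d x n) = Bx (q y n) (d y n) := by
        change Bx (st (PiNat.res x n)).1.1 (st (PiNat.res x n)).2 = _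
        rw [ag_iff_res.1 hy]
      rw [← h3, ← Bx_eq h2] at h1
      exact Bx_mono (dge x n) h1
    exact E.cs.comp_continuous hzc hzs
  · intro y m
    induction m with
    | zero => exact ⟨0, fun x x' _ _ => Ag.zero _ _⟩
    | succ m ih =>
      obtain ⟨n, hn⟩ := ih
      by_cases hx : ∃ x, Ag n y (E.e (z x))
      · obtain ⟨x0, hx0⟩ := hx
        obtain ⟨n', hn'⟩ := n4 (PiNat.res x0 m) (st (PiNat.res x0 m)) y
        have key : ∀ x, Ag n y (E.e (z x)) →
            z x ∈ Bx (nx (PiNat.res x0 m) (st (PiNat.res x0 m)) (x m)).1.1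
              (nx (PiNat.res x0 m) (st (PiNat.res x0 m)) (x m)).2 := by
          intro x hx
          rw [ag_iff_res.1 (hn x0 x hx0 hx)]
          exact hz x (m + 1)
        refine ⟨max n n', fun x x' h1 h2 i hi => ?_⟩
        have h1' := h1.mono (le_max_left n n')
        have h2' := h2.mono (le_max_left n n')
        rcases Nat.lt_succ_iff_lt_or_eq.1 hi with hi | rfl
        · exact hn x x' h1' h2' i hi
        · exact hn' _ _ _ _ (key x h1') (hzs x) (key x' h2') (hzs x')
            (h1.mono (le_max_right n n')) (h2.mono (le_max_right n n'))
      · exact ⟨n, fun x x' h1 _ => absurd ⟨x, h1⟩ hx⟩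

end Univ
end DH

namespace DH

section Gds
variable {X K : Type*} [TopologicalSpace X] [TopologicalSpace K]

theorem gds_of_isGδ {s : Set X} (h : IsGδ s) : IsGdeltaSigma s :=
  ⟨fun _ => s, fun _ => h, (iUnion_const s).symm⟩

theorem gds_iUnion {s : ℕ → Set X} (h : ∀ n, IsGdeltaSigma (s n)) : IsGdeltaSigma (⋃ n, s n) := by
  choose G hG hs using h
  refine ⟨fun m => G m.unpair.1 m.unpair.2, fun m => hG _ _, ?_⟩
  ext x
  simp only [mem_iUnion]
  constructor
  · rintro ⟨n, hx⟩
    rw [hs n] at hx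
    obtain ⟨j, hj⟩ := mem_iUnion.1 hx
    exact ⟨Nat.pair n j, by simpa using hj⟩
  · rintro ⟨m, hm⟩
    exact ⟨m.unpair.1, by rw [hs]; exact mem_iUnion.2 ⟨_, hm⟩⟩

theorem gds_iUnion_rat {s : ℚ → Set X} (h : ∀ n, IsGdeltaSigma (s n)) :
    IsGdeltaSigma (⋃ n, s n) := by
  obtain ⟨f, hf⟩ := exists_surjective_nat ℚ
  rw [← hf.iUnion_comp]
  exact gds_iUnion fun n => h (f n)

theorem gds_union {s t : Set X} (hs : IsGdeltaSigma s) (ht : IsGdeltaSigma t) :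
    IsGdeltaSigma (s ∪ t) := by
  have : s ∪ t = ⋃ n : ℕ, (if n = 0 then s else t) := by
    ext x
    simp only [mem_union, mem_iUnion]
    constructor
    · rintro (h | h)
      · exact ⟨0, by simpa using h⟩
      · exact ⟨1, by simpa using h⟩
    · rintro ⟨n, hn⟩
      split_ifs at hn
      · exact Or.inl hn
      · exact Or.inr hn
  rw [this]
  refine gds_iUnion fun n => ?_
  split_ifs
  · exact hs
  · exact ht

theorem gds_compl_of_isGδ [TopologicalSpace.MetrizableSpace X] {s : Set X} (h : IsGδ s) :
    IsGdeltaSigma sᶜ := by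
  obtain ⟨U, hU, rfl⟩ := h.eq_iInter_nat
  rw [compl_iInter]
  exact gds_iUnion fun n => gds_of_isGδ (isGδ_closed (hU n).isClosed_compl)

theorem gds_inter_preimage {f : X → K} {s : Set X} (hs : IsGδ s) (hf : ContinuousOn f s)
    {t : Set K} (ht : IsGdeltaSigma t) : IsGdeltaSigma (s ∩ f ⁻¹' t) := by
  obtain ⟨G, hG, rfl⟩ := ht
  refine ⟨fun n => s ∩ f ⁻¹' G n, fun n => isGδ_inter_preimage hs hf (hG n), ?_⟩
  rw [preimage_iUnion, inter_iUnion]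

/-- A `GH` map matching two sets. -/
structure Sp (E : GH X K) (S : Set X) (S' : Set K) : Prop where
  hs : S ⊆ E.e.source
  ht : S' ⊆ E.e.target
  iff : ∀ z ∈ E.e.source, (E.e z ∈ S' ↔ z ∈ S)

variable {E : GH X K} {S : Set X} {S' : Set K}

theorem Sp.iff' (h : Sp E S S') {w : K} (hw : w ∈ E.e.target) : E.e.symm w ∈ S ↔ w ∈ S' := by
  rw [← h.iff _ (E.e.map_target hw), E.e.right_inv hw]

theorem Sp.gds (h : Sp E S S') (hS : IsGdeltaSigma S) : IsGdeltaSigma S' := by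
  have : S' = E.e.target ∩ E.e.symm ⁻¹' S := by
    ext w
    constructor
    · intro hw; exact ⟨h.ht hw, (h.iff' (h.ht hw)).2 hw⟩
    · rintro ⟨h1, h2⟩; exact (h.iff' h1).1 h2
  rw [this]
  exact gds_inter_preimage E.gt E.ct hS

theorem Sp.gds_compl [TopologicalSpace.MetrizableSpace K] (h : Sp E S S')
    (hS : IsGdeltaSigma Sᶜ) : IsGdeltaSigma S'ᶜ := by
  have : S'ᶜ = E.e.targetᶜ ∪ E.e.target ∩ E.e.symm ⁻¹' Sᶜ := by
    ext w
    by_cases hw : w ∈ E.e.target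
    · have := h.iff' hw
      simp only [mem_compl_iff, mem_union, mem_inter_iff, mem_preimage, hw, this]
      simp
    · simp only [mem_compl_iff, mem_union, mem_inter_iff, mem_preimage, hw]
      simpa using fun h' => hw (h.ht h')
  rw [this]
  exact gds_union (gds_compl_of_isGδ E.gt) (gds_inter_preimage E.gt E.ct hS)

/-- pulling back an open set -/
theorem GH.pull (E : GH X K) {U : Set K} (hU : IsOpen U) :
    ∃ O, IsOpen O ∧ ∀ z ∈ E.e.source, (z ∈ O ↔ E.e z ∈ U) := by
  obtain ⟨O, hO, h⟩ := continuousOn_iff'.1 E.cs U hU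
  refine ⟨O, hO, fun z hz => ?_⟩
  have := Set.ext_iff.1 h z
  simp only [mem_inter_iff, mem_preimage, hz, and_true] at this
  exact this.symm

end Gds

section Chain
variable {D T : Type u} [TopologicalSpace D] [DiscreteTopology D]
  [TopologicalSpace T] [DiscreteTopology T]

theorem lav_sp {T' : Type*} [TopologicalSpace T'] [DiscreteTopology T'] [Nonempty T] [Nonempty T']
    (S : Set (ℕ → T)) (S' : Set (ℕ → T')) (f : S ≃ₜ S') :
    ∃ E : GH (ℕ → T) (ℕ → T'), Sp E S S' ∧ E.e.target ⊆ closure S' := by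
  obtain ⟨E, h1, h2, h3, h4⟩ := lavrentiev S S' f
  refine ⟨E, ⟨h1, h2, fun z hz => ⟨fun h => ?_, fun h => ?_⟩⟩, h4⟩
  · have h5 : E.e (f.symm ⟨_, h⟩ : S) = E.e z := by rw [h3, f.apply_symm_apply]
    have h6 := E.e.injOn (h1 (f.symm ⟨_, h⟩ : S).2) hz h5
    rw [← h6]
    exact Subtype.coe_prop _
  · rw [h3 ⟨z, h⟩]
    exact Subtype.coe_prop _

/-- uncurrying -/
def flat (D : Type*) [TopologicalSpace D] : (ℕ → ℕ → D) ≃ₜ (ℕ → D) where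
  toFun z n := z n.unpair.1 n.unpair.2
  invFun x i j := x (Nat.pair i j)
  left_inv z := by funext i j; simp
  right_inv x := by funext n; simp
  continuous_toFun := by fun_prop
  continuous_invFun := by fun_prop

theorem first_sp [Nonempty D] [Nonempty T] (S : Set (ℕ → ℕ → D)) (S' : Set (ℕ → T)) (f : S ≃ₜ S') :
    ∃ E : GH (ℕ → ℕ → D) (ℕ → T), Sp E S S' := by
  obtain ⟨E, h, -⟩ := lav_sp (flat D '' S) S' (((flat D).image S).symm.trans f)
  refine ⟨(GH.ofHomeo (flat D)).trans E, ?_, ?_, ?_⟩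
  · intro z hz
    exact ⟨trivial, h.hs (mem_image_of_mem _ hz)⟩
  · intro w hw
    exact ⟨h.ht hw, trivial⟩
  · intro z hz
    refine (h.iff (flat D z) hz.2).trans ?_
    exact (flat D).injective.mem_set_image

theorem gds_compl_Qw (o : D) : IsGdeltaSigma (Qw o)ᶜ := by
  have : (Qw o)ᶜ = ⋃ i, ⋂ N, ⋃ j ∈ Ici N, {z : ℕ → ℕ → D | z i j ≠ o} := by
    ext z
    simp only [Qw, mem_compl_iff, mem_ofPred_eq, mem_iUnion, mem_iInter, eventually_atTop, mem_Ici]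
    push Not
    simp
  rw [this]
  refine gds_iUnion fun i => gds_of_isGδ (IsGδ.iInter_of_isOpen fun N => ?_)
  refine isOpen_biUnion fun j _ => ?_
  exact (isOpen_discrete {a | a ≠ o}).preimage (f := fun z : ℕ → ℕ → D => z i j) (by fun_prop)

/-- fibres over the rationals -/
def fib {Y B : Set (ℕ → T)} (eY : Y ≃ₜ ℚ × B) (q : ℚ) : Set (ℕ → T) :=
  {y | ∃ h : y ∈ Y, (eY ⟨y, h⟩).1 = q}

variable {A Y X B : Set (ℕ → T)}

/-- the fibre is a copy -/
def fibHomeo (eY : Y ≃ₜ ℚ × B) (q : ℚ) : B ≃ₜ fib eY q where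
  toFun b := ⟨eY.symm (q, b), Subtype.coe_prop _, by simp⟩
  invFun y := (eY ⟨y.1, y.2.1⟩).2
  left_inv b := by simp
  right_inv y := by
    obtain ⟨y, hy, rfl⟩ := y
    apply Subtype.ext
    simp
  continuous_toFun := by
    refine Continuous.subtype_mk ?_ _
    fun_prop
  continuous_invFun := by
    have : Continuous fun y : fib eY q => (⟨y.1, y.2.1⟩ : Y) := by
      refine Continuous.subtype_mk ?_ _
      fun_prop
    exact continuous_snd.comp (eY.continuous.comp this)

theorem fib_iUnion (eY : Y ≃ₜ ℚ × B) : ⋃ q, fib eY q = Y := by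
  ext y
  simp only [mem_iUnion]
  constructor
  · rintro ⟨q, h, -⟩; exact h
  · intro h; exact ⟨_, h, rfl⟩

theorem fib_closed (eY : Y ≃ₜ ℚ × B) (q : ℚ) {y : ℕ → T} (hy : y ∈ Y)
    (hc : y ∈ closure (fib eY q)) : y ∈ fib eY q := by
  refine ⟨hy, ?_⟩
  have h1 : IsClosed {y : Y | (eY y).1 = q} :=
    isClosed_singleton.preimage (continuous_fst.comp eY.continuous)
  have h2 : (⟨y, hy⟩ : Y) ∈ closure {y : Y | (eY y).1 = q} := by
    rw [closure_subtype]
    refine closure_mono ?_ hc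
    rintro y ⟨h, h'⟩
    exact ⟨⟨y, h⟩, h', rfl⟩
  rw [h1.closure_eq] at h2
  exact h2

theorem fib_nd (eY : Y ≃ₜ ℚ × B) (hY : Dense Y) (q : ℚ) : interior (closure (fib eY q)) = ∅ := by
  by_contra hne
  obtain ⟨y, hyV, hy⟩ := hY.inter_open_nonempty _ isOpen_interior (nonempty_iff_ne_empty.2 hne)
  set V := interior (closure (fib eY q)) with hV
  have h1 : IsOpen {q' : ℚ | (eY.symm (q', (eY ⟨y, hy⟩).2) : ℕ → T) ∈ V} :=
    isOpen_interior.preimage (by fun_prop)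
  have h2 : {q' : ℚ | (eY.symm (q', (eY ⟨y, hy⟩).2) : ℕ → T) ∈ V} = {q} := by
    have hyq := fib_closed eY q hy (interior_subset hyV)
    obtain ⟨h, hq⟩ := hyq
    refine Subset.antisymm ?_ ?_
    · intro q' hq'
      obtain ⟨h3, h4⟩ := fib_closed eY q (Subtype.coe_prop _) (interior_subset hq')
      simpa using h4
    · rintro q' rfl
      rw [← hq]
      simpa using hyV
  rw [h2] at h1
  exact not_isOpen_singleton q h1

theorem gds_final [Nonempty D] [Nonempty T] (o : D) (eA : Qw o ≃ₜ A) (eY : Y ≃ₜ ℚ × (Aᶜ : Set (ℕ → T)))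
    (eX : (Yᶜ : Set (ℕ → T)) ≃ₜ X) : IsGdeltaSigma Xᶜ := by
  obtain ⟨E0, h0⟩ := first_sp _ _ eA
  have hA : IsGdeltaSigma Aᶜ := h0.gds_compl (gds_compl_Qw o)
  have hY : IsGdeltaSigma Y := by
    rw [← fib_iUnion eY]
    refine gds_iUnion_rat fun q => ?_
    obtain ⟨E1, h1, -⟩ := lav_sp _ _ (fibHomeo eY q)
    exact h1.gds hA
  obtain ⟨E2, h2, -⟩ := lav_sp _ _ eX
  exact h2.gds_compl (by rwa [compl_compl])

theorem meager_final [Nonempty T] (eY : Y ≃ₜ ℚ × B) (hY : Dense Y)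
    (eX : (Yᶜ : Set (ℕ → T)) ≃ₜ X) (hX : Dense X) :
    ∃ Z : ℕ → Set (ℕ → T), (∀ n, IsClosed (Z n)) ∧ (∀ n, interior (Z n) = ∅) ∧
      Xᶜ ⊆ ⋃ n, Z n := by
  obtain ⟨E2, h2, -⟩ := lav_sp _ _ eX
  let H : Set (ℕ → T) := ⋂ q, (closure (fib eY q))ᶜ
  have hHd : Dense H := by
    refine dense_iInter_of_isOpen (fun q => isClosed_closure.isOpen_compl) fun q => ?_
    rw [← interior_eq_empty_iff_dense_compl]
    exact fib_nd eY hY q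
  have hHg : IsGδ H := IsGδ.iInter_of_isOpen fun q => isClosed_closure.isOpen_compl
  have hHY : H ⊆ Yᶜ := by
    intro x hx hxY
    rw [← fib_iUnion eY] at hxY
    obtain ⟨q, hq⟩ := mem_iUnion.1 hxY
    exact mem_iInter.1 hx q (subset_closure hq)
  have hN := isGδ_inter_preimage E2.gt E2.ct hHg
  have hNX : E2.e.target ∩ E2.e.symm ⁻¹' H ⊆ X := fun w hw => (h2.iff' hw.1).1 (hHY hw.2)
  have hNd : Dense (E2.e.target ∩ E2.e.symm ⁻¹' H) := by
    rw [dense_iff_inter_open]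
    intro U hU hne
    obtain ⟨x, hxU, hx⟩ := hX.inter_open_nonempty U hU hne
    obtain ⟨O, hO, hOU⟩ := E2.pull hU
    have hxt := h2.ht hx
    obtain ⟨h, hhO, hh⟩ := hHd.inter_open_nonempty O hO
      ⟨_, (hOU _ (E2.e.map_target hxt)).2 (by rwa [E2.e.right_inv hxt])⟩
    have hhs := h2.hs (hHY hh)
    refine ⟨E2.e h, (hOU h hhs).1 hhO, E2.e.map_source hhs, ?_⟩
    rw [mem_preimage, E2.e.left_inv hhs]
    exact hh
  obtain ⟨W, hW, hWe⟩ := hN.eq_iInter_nat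
  refine ⟨fun n => (W n)ᶜ, fun n => (hW n).isClosed_compl, fun n => ?_, ?_⟩
  · rw [interior_eq_empty_iff_dense_compl, compl_compl]
    refine hNd.mono ?_
    rw [hWe]
    exact iInter_subset _ _
  · rw [← compl_iInter, ← hWe]
    exact compl_subset_compl.2 hNX

theorem emb_final [Nonempty D] [Nonempty T] (o : D) (ι : T → D) (hι : Function.Injective ι)
    (hD : ∃ a : D, a ≠ o) (hT : Finite T ∨ Uncountable T)
    (hA : Dense A) (hY : Dense Y) (hX : Dense X)
    (eA : Qw o ≃ₜ A) (eY : Y ≃ₜ ℚ × (Aᶜ : Set (ℕ → T)))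
    (eX : (Yᶜ : Set (ℕ → T)) ≃ₜ X) {P : Set (ℕ → T)} (hP : IsGdeltaSigma Pᶜ) :
    Emb Pᶜ Xᶜ := by
  obtain ⟨G, hG, hPG⟩ := hP
  obtain ⟨c, hc⟩ := flags hG hPG
  intro U hU hne
  obtain ⟨E0, h0⟩ := first_sp _ _ eA
  obtain ⟨E2, h2, -⟩ := lav_sp _ _ eX
  obtain ⟨x, hxU, hx⟩ := hX.inter_open_nonempty U hU hne
  obtain ⟨O2, hO2, hOU2⟩ := E2.pull hU
  have hxt := h2.ht hx
  obtain ⟨y, hyO, hy⟩ := hY.inter_open_nonempty O2 hO2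
    ⟨_, (hOU2 _ (E2.e.map_target hxt)).2 (by rwa [E2.e.right_inv hxt])⟩
  obtain ⟨E1, h1, h1c⟩ := lav_sp _ _ (fibHomeo eY (eY ⟨y, hy⟩).1)
  have h1Y : ∀ z ∈ E1.e.source, (E1.e z ∈ Y ↔ z ∈ Aᶜ) := by
    intro z hz
    rw [← h1.iff z hz]
    exact ⟨fun h => fib_closed eY _ h (h1c (E1.e.map_source hz)), fun h => h.1⟩
  obtain ⟨O1, hO1, hOU1⟩ := E1.pull hO2
  have hyt := h1.ht (⟨hy, rfl⟩ : y ∈ fib eY (eY ⟨y, hy⟩).1)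
  obtain ⟨a, haO, ha⟩ := hA.inter_open_nonempty O1 hO1
    ⟨_, (hOU1 _ (E1.e.map_target hyt)).2 (by rwa [E1.e.right_inv hyt])⟩
  obtain ⟨O0, hO0, hOU0⟩ := E0.pull hO1
  have hat := h0.ht ha
  have hq0 : E0.e.symm a ∈ Qw o := (h0.iff' hat).2 ha
  have hqO : E0.e.symm a ∈ O0 := (hOU0 _ (E0.e.map_target hat)).2 (by rwa [E0.e.right_inv hat])
  obtain ⟨d0, hd0⟩ := mem_nhds_iff_Bx.1 (hO0.mem_nhds hqO)
  have hR1 : Rich o (E0.trans E1).e.source := by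
    refine rich_lemma o hD E0.gs (E0.trans E1).gs h0.hs ?_
    rintro z ⟨hz, hz'⟩
    rw [← h0.iff z hz]
    by_contra hzA
    exact hz' ⟨hz, h1.hs hzA⟩
  have hR2 : Rich o ((E0.trans E1).trans E2).e.source := by
    intro q hq d
    obtain ⟨q', hq', hqs, hqd⟩ := hR1 q hq d
    refine ⟨q', hq', ⟨hqs, ?_⟩, hqd⟩
    refine h2.hs fun hYq => ?_
    exact (h1Y _ hqs.2).1 hYq ((h0.iff q' hqs.1).2 hq')
  have hbox : ∀ z ∈ Bx (E0.e.symm a) d0, z ∈ ((E0.trans E1).trans E2).e.source →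
      ((E0.trans E1).trans E2).e z ∈ U := by
    rintro z hz ⟨⟨s0, s1⟩, s2⟩
    exact (hOU2 _ s2).1 ((hOU1 _ s1).1 ((hOU0 _ s0).1 (hd0 hz)))
  obtain ⟨z, z1, z2, z3, z4⟩ := universal o ι hι hD hT ((E0.trans E1).trans E2) hR2 hq0 d0 hbox hc
  refine ⟨_, z4, ?_, fun x => ?_⟩
  · rintro _ ⟨x, rfl⟩
    exact z3 x
  · obtain ⟨⟨s0, s1⟩, s2⟩ := z1 x
    refine not_congr ?_
    rw [← z2 x, ← h0.iff _ s0]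
    have e1 := h2.iff _ s2
    have e2 := h1Y _ s1
    refine e1.trans ((not_congr e2).trans ?_)
    exact not_not

theorem final [Nontrivial T] (o : D) (ι : T → D) (hι : Function.Injective ι)
    (hD : ∃ a : D, a ≠ o) (hT : Finite T ∨ Uncountable T) {A' Y' X' : Set (ℕ → T)}
    (hA : Dense A) (hY : Dense Y) (hX : Dense X)
    (eA : Qw o ≃ₜ A) (eY : Y ≃ₜ ℚ × (Aᶜ : Set (ℕ → T)))
    (eX : (Yᶜ : Set (ℕ → T)) ≃ₜ X)
    (hA' : Dense A') (hY' : Dense Y') (hX' : Dense X')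
    (eA' : Qw o ≃ₜ A') (eY' : Y' ≃ₜ ℚ × (A'ᶜ : Set (ℕ → T)))
    (eX' : (Y'ᶜ : Set (ℕ → T)) ≃ₜ X') :
    ∃ f : (ℕ → T) ≃ₜ (ℕ → T), f '' X = X' := by
  have : Nonempty D := ⟨o⟩
  obtain ⟨Z, z1, z2, z3⟩ := meager_final eY hY eX hX
  obtain ⟨Z', z1', z2', z3'⟩ := meager_final eY' hY' eX' hX'
  obtain ⟨f, hf⟩ := back_forth z1 z2 z1' z2' z3 z3'
    (emb_final o ι hι hD hT hA' hY' hX' eA' eY' eX' (gds_final o eA eY eX))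
    (emb_final o ι hι hD hT hA hY hX eA eY eX (gds_final o eA' eY' eX'))
  refine ⟨f, ?_⟩
  ext y
  obtain ⟨x, rfl⟩ := f.surjective y
  rw [f.injective.mem_set_image]
  have := hf x
  simp only [mem_compl_iff] at this
  exact not_iff_not.1 this

end Chain
end DH

namespace DH

/-- a power of a subspace as a subspace. -/
def powHomeo {D : Type u} [TopologicalSpace D] (o : D) :
    (ℕ → {x : ℕ → D // ∀ᶠ n in Filter.atTop, x n = o}) ≃ₜ Qw o where
  toFun z := ⟨fun i => (z i).1, fun i => (z i).2⟩
  invFun z := fun i => ⟨z.1 i, z.2 i⟩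
  left_inv z := rfl
  right_inv z := rfl
  continuous_toFun := by
    refine Continuous.subtype_mk (continuous_pi fun i => ?_) _
    exact continuous_subtype_val.comp (continuous_apply i)
  continuous_invFun := by
    refine continuous_pi fun i => ?_
    refine Continuous.subtype_mk ?_ _
    exact (continuous_apply (A := fun _ : ℕ => ℕ → D) i).comp continuous_subtype_val

/-- base point -/
def qo (k : Cardinal.{u}) : QBase k := Sum.inr PUnit.unit

/-- `Q(k)^ω` as a subspace. -/
def qwHomeo (k : Cardinal.{u}) :
    QkOmega k ≃ₜ Qw (qo k) :=
  powHomeo (qo k)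

theorem mk_DiscT (k : Cardinal.{u}) : Cardinal.mk (DiscT k) = k := Cardinal.mk_out k

theorem starT_facts (k : Cardinal.{u}) (hk : Cardinal.aleph0 ≤ k) :
    Nontrivial (StarT k) ∧ (Finite (StarT k) ∨ Uncountable (StarT k)) ∧
      ∃ ι : StarT k → QBase k, Function.Injective ι := by
  have hinf : Infinite (DiscT k) := by
    rw [Cardinal.infinite_iff, mk_DiscT]; exact hk
  by_cases h : k = Cardinal.aleph0
  · have e : StarT k = ULift Bool := if_pos h
    rw [e]
    refine ⟨inferInstance, Or.inl inferInstance, ?_⟩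
    obtain ⟨j⟩ : Nonempty (ULift.{u} Bool ↪ DiscT k) := by
      rw [← Cardinal.le_def, mk_DiscT]
      exact (Cardinal.lt_aleph0_of_finite _).le.trans hk
    exact ⟨fun a => Sum.inl (j a), fun a b hab => j.injective (Sum.inl_injective hab)⟩
  · have e : StarT k = DiscT k := if_neg h
    rw [e]
    refine ⟨inferInstance, Or.inr ?_, Sum.inl, Sum.inl_injective⟩
    rw [← Cardinal.aleph0_lt_mk_iff, mk_DiscT]
    exact lt_of_le_of_ne hk (Ne.symm h)

end DH

/-- Theorem `t-dhm2`: `B*(k)` is densely homogeneous with respect to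
the space `M^{II}_k`. -/
theorem stmt_19 (k : Cardinal.{u}) (hk : Cardinal.aleph0 ≤ k)
    (X₁ X₂ : Set (BaireStar k)) (hd₁ : Dense X₁) (hd₂ : Dense X₂)
    (he₁ : IsMII k ↥X₁) (he₂ : IsMII k ↥X₂) :
    ∃ f : BaireStar k ≃ₜ BaireStar k, f '' X₁ = X₂ := by
  obtain ⟨hn, hT, ι, hι⟩ := DH.starT_facts k hk
  obtain ⟨Y, hY, ⟨A, hA, ⟨eA⟩, ⟨eY⟩⟩, ⟨eX⟩⟩ := he₁
  obtain ⟨Y', hY', ⟨A', hA', ⟨eA'⟩, ⟨eY'⟩⟩, ⟨eX'⟩⟩ := he₂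
  have hD : ∃ a : QBase k, a ≠ DH.qo k := by
    have hinf : Infinite (DiscT k) := by
      rw [Cardinal.infinite_iff, DH.mk_DiscT]; exact hk
    exact ⟨Sum.inl (Classical.arbitrary (DiscT k)), Sum.inl_ne_inr⟩
  exact DH.final (T := StarT k) (DH.qo k) ι hι hD hT hA hY hd₁
    ((DH.qwHomeo k).symm.trans eA.symm) eY eX.symm hA' hY' hd₂
    ((DH.qwHomeo k).symm.trans eA'.symm) eY' eX'.symm
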